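/- arXiv:0810.2067 — 6 statements merged into one kernel-verified Lean document; each statement's English description precedes it below -/
import Mathlib

section
/- (Canfield–Erdős–Pomerance bound) For every ε > 0 and every δ > 0 there exists u₀ such that for all real numbers x, y ≥ 2 satisfying y ≥ (log x)^{1+ε}, if u := (log x)/(log y) ≥ u₀, then x · u^{-(1+δ)u} ≤ ψ(x,y) ≤ x · u^{-(1-δ)u}. -/
open scoped Classical

/-- `smoothCount x y` = ψ(x,y), the number of `y`-smooth positive integers `n ≤ x`. -/
noncomputable def smoothCount (x y : ℝ) : ℕ :=
  ((Finset.Icc 1 ⌊x⌋₊).filter (fun n => ∀ p : ℕ, p ∈ n.primeFactors → (p : ℝ) ≤ y)).card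

section SmoothCount

open Real Filter Finset

/-- The primes `p` with `a < p ≤ b`. -/
noncomputable def primesBetween (a b : ℝ) : Finset ℕ :=
  (Nat.primesLE ⌊b⌋₊).filter (fun p => a < p)

theorem mem_primesBetween {a b : ℝ} (hb : 0 ≤ b) {p : ℕ} :
    p ∈ primesBetween a b ↔ p.Prime ∧ a < p ∧ (p : ℝ) ≤ b := by
  simp only [primesBetween, mem_filter, Nat.mem_primesLE, Nat.le_floor_iff hb]
  tauto

theorem theta_sub_theta_le (a b : ℝ) :
    Chebyshev.theta b - Chebyshev.theta a ≤ ∑ p ∈ primesBetween a b, log p := by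
  rw [Chebyshev.theta_eq_sum_primesLE b, Chebyshev.theta_eq_sum_primesLE a,
    ← sum_filter_add_sum_filter_not (Nat.primesLE ⌊b⌋₊) (fun p : ℕ => a < p)]
  have : ∑ p ∈ (Nat.primesLE ⌊b⌋₊).filter (fun p : ℕ => ¬ a < p), log p ≤
      ∑ p ∈ Nat.primesLE ⌊a⌋₊, log p := by
    refine sum_le_sum_of_subset_of_nonneg ?_ fun p hp _ =>
      log_nonneg (by exact_mod_cast (Nat.one_lt_of_mem_primesLE hp).le)
    intro p hp
    simp only [mem_filter, Nat.mem_primesLE, not_lt] at hp ⊢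
    exact ⟨Nat.le_floor hp.2, hp.1.2⟩
  have h2 : ∑ p ∈ primesBetween a b, log p =
    ∑ p ∈ (Nat.primesLE ⌊b⌋₊).filter (fun p : ℕ => a < p), log p := rfl
  linarith

theorem exists_mul_log_two_le_theta_sub :
    ∃ z₀ : ℝ, 1 ≤ z₀ ∧ ∀ z, z₀ ≤ z →
      z * log 2 ≤ Chebyshev.theta (4 * z) - Chebyshev.theta z := by
  have hl2 : 0 < log 2 := log_pos one_lt_two
  have h := (isLittleO_log_rpow_atTop (r := 1 / 2) (by norm_num)).bound
    (c := log 2 / 20) (by positivity)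
  obtain ⟨w₀, hw⟩ := eventually_atTop.1 h
  refine ⟨max w₀ 1, le_max_right _ _, fun z hz => ?_⟩
  have hz1 : 1 ≤ z := (le_max_right _ _).trans hz
  have hw1 := hw (4 * z) (by linarith [le_max_left w₀ 1])
  rw [← sqrt_eq_rpow, norm_of_nonneg (log_nonneg (by linarith)),
    norm_of_nonneg (sqrt_nonneg _)] at hw1
  have h1 := Chebyshev.theta_ge' (x := 4 * z) (by linarith)
  have h2 := Chebyshev.theta_le_log4_mul_x (x := z) (by linarith)
  have h4 : log 4 = 2 * log 2 := by
    rw [show (4 : ℝ) = 2 ^ 2 by norm_num, log_pow]; norm_num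
  have h5 : log (4 * z + 2) ≤ 2 * log (4 * z) := by
    rw [← Nat.cast_two (R := ℝ), ← log_pow]
    exact log_le_log (by positivity) (by push_cast; nlinarith)
  have h6 : log 2 ≤ log (4 * z) := log_le_log (by norm_num) (by linarith)
  have h7 : 1 ≤ √(4 * z) := by rw [one_le_sqrt]; linarith
  have h8 : √(4 * z) * √(4 * z) = 4 * z := mul_self_sqrt (by linarith)
  rw [h4] at h2
  have h9 : √(4 * z) * log (4 * z) ≤ log 2 / 20 * (4 * z) := by
    calc √(4 * z) * log (4 * z) ≤ √(4 * z) * (log 2 / 20 * √(4 * z)) := by gcongr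
      _ = log 2 / 20 * (√(4 * z) * √(4 * z)) := by ring
      _ = log 2 / 20 * (4 * z) := by rw [h8]
  nlinarith

theorem exists_div_log_le_sum_primesBetween_four :
    ∃ z₀ : ℝ, 1 ≤ z₀ ∧ ∀ z y, z₀ ≤ z → 4 * z ≤ y →
      log 2 / 4 / log y ≤ ∑ p ∈ primesBetween z (4 * z), (1 : ℝ) / p := by
  obtain ⟨z₀, hz₀, h⟩ := exists_mul_log_two_le_theta_sub
  refine ⟨z₀, hz₀, fun z y hz hy => ?_⟩
  have hz0 : 0 < z := by linarith
  have hlog : 0 < log y := log_pos (by linarith)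
  have h1 := (h z hz).trans (theta_sub_theta_le _ _)
  have h2 : ∑ p ∈ primesBetween z (4 * z), log p ≤
      ∑ p ∈ primesBetween z (4 * z), (4 * z * log y) * ((1 : ℝ) / p) := by
    refine sum_le_sum fun p hp => ?_
    obtain ⟨hp, hp1, hp2⟩ := (mem_primesBetween (by linarith)).1 hp
    have hp0 : (0 : ℝ) < p := by linarith
    rw [mul_one_div, le_div_iff₀ hp0]
    have : log p ≤ log y := log_le_log hp0 (by linarith)
    have := log_nonneg (x := (p : ℝ)) (by linarith)
    nlinarith
  rw [← mul_sum] at h2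
  rw [div_le_iff₀ hlog]
  have h3 := h1.trans h2
  have : z * log 2 ≤ z * (4 * log y * ∑ p ∈ primesBetween z (4 * z), (1 : ℝ) / p) := by linarith
  have := le_of_mul_le_mul_left this hz0
  linarith

theorem exists_mul_div_log_le_sum_primesBetween :
    ∃ z₀ : ℝ, 1 ≤ z₀ ∧ ∀ z y, z₀ ≤ z → ∀ J : ℕ, 4 ^ J * z ≤ y →
      J * (log 2 / 4 / log y) ≤ ∑ p ∈ primesBetween z (4 ^ J * z), (1 : ℝ) / p := by
  obtain ⟨z₀, hz₀, h⟩ := exists_div_log_le_sum_primesBetween_four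
  refine ⟨z₀, hz₀, fun z y hz J => ?_⟩
  have hz0 : 0 < z := by linarith
  induction J with
  | zero => intro _; simpa using sum_nonneg fun p _ => by positivity
  | succ J ih =>
    intro hy
    have h4 : (1 : ℝ) ≤ 4 ^ J := one_le_pow₀ (by norm_num)
    rw [pow_succ] at hy ⊢
    have hJ : z ≤ 4 ^ J * z := by nlinarith
    have h1 := ih (by nlinarith)
    have h2 := h (4 ^ J * z) y (by linarith) (by linarith)
    have hdisj : Disjoint (primesBetween z (4 ^ J * z))
        (primesBetween (4 ^ J * z) (4 * (4 ^ J * z))) := by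
      rw [disjoint_left]
      intro p hp hp'
      rw [mem_primesBetween (by positivity)] at hp hp'
      linarith [hp.2.2, hp'.2.1]
    have h3 : ∑ p ∈ primesBetween z (4 ^ J * z), (1 : ℝ) / p +
        ∑ p ∈ primesBetween (4 ^ J * z) (4 * (4 ^ J * z)), (1 : ℝ) / p ≤
        ∑ p ∈ primesBetween z (4 ^ J * 4 * z), (1 : ℝ) / p := by
      rw [← sum_union hdisj]
      refine sum_le_sum_of_subset_of_nonneg ?_ fun p _ _ => by positivity
      intro p hp
      rw [mem_union, mem_primesBetween (by positivity), mem_primesBetween (by positivity)] at hp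
      rw [mem_primesBetween (by positivity)]
      rcases hp with ⟨h, h', h''⟩ | ⟨h, h', h''⟩
      · exact ⟨h, h', by nlinarith⟩
      · exact ⟨h, by linarith, by linarith⟩
    push_cast
    linarith

theorem exists_le_sum_primesBetween {η : ℝ} (hη : 0 < η) (hη1 : η < 1) :
    ∃ y₀ : ℝ, ∀ y, y₀ ≤ y →
      η / 16 ≤ ∑ p ∈ primesBetween (y ^ (1 - η)) y, (1 : ℝ) / p := by
  obtain ⟨z₀, hz₀, h⟩ := exists_mul_div_log_le_sum_primesBetween
  have hl2 : 0 < log 2 := log_pos one_lt_two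
  have h4 : log 4 = 2 * log 2 := by
    rw [show (4 : ℝ) = 2 ^ 2 by norm_num, log_pow]; norm_num
  have e1 := (tendsto_rpow_atTop (y := 1 - η) (by linarith)).eventually_ge_atTop z₀
  have e2 := tendsto_log_atTop.eventually_ge_atTop (4 * log 2 / η)
  obtain ⟨y₀, hy₀⟩ := eventually_atTop.1 (e1.and (e2.and (eventually_gt_atTop 1)))
  refine ⟨y₀, fun y hy => ?_⟩
  obtain ⟨hy1, hy2, hy3⟩ := hy₀ y hy
  have hlog : 0 < log y := log_pos hy3
  have hy0 : 0 < y := by linarith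
  set J := ⌊η * log y / log 4⌋₊
  have hl4 : 0 < log 4 := by linarith
  have hJ1 : J * log 4 ≤ η * log y := by
    rw [← le_div_iff₀ hl4]; exact Nat.floor_le (by positivity)
  have hJ2 : η * log y < (J + 1) * log 4 := by
    rw [← div_lt_iff₀ hl4]; exact Nat.lt_floor_add_one _
  have hle : 4 ^ J * y ^ (1 - η) ≤ y := by
    rw [← log_le_log_iff (by positivity) hy0, log_mul (by positivity) (by positivity), log_pow,
      log_rpow hy0]
    linarith
  have h1 := h _ y hy1 J hle
  have h2 : ∑ p ∈ primesBetween (y ^ (1 - η)) (4 ^ J * y ^ (1 - η)), (1 : ℝ) / p ≤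
      ∑ p ∈ primesBetween (y ^ (1 - η)) y, (1 : ℝ) / p := by
    refine sum_le_sum_of_subset_of_nonneg ?_ fun p _ _ => by positivity
    intro p hp
    rw [mem_primesBetween (by positivity)] at hp ⊢
    exact ⟨hp.1, hp.2.1, hp.2.2.trans hle⟩
  refine le_trans ?_ (h1.trans h2)
  rw [div_le_iff₀ hη] at hy2
  rw [h4] at hJ2
  rw [div_div, mul_div_assoc', le_div_iff₀ (by positivity)]
  nlinarith

theorem smoothCount_eq_floor {x y : ℝ} (hx : 0 ≤ x) (hxy : x ≤ y) : smoothCount x y = ⌊x⌋₊ := by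
  rw [smoothCount, filter_true_of_mem, Nat.card_Icc, Nat.add_sub_cancel]
  intro n hn p hp
  rw [mem_Icc] at hn
  have h1 : p ≤ n := Nat.le_of_dvd hn.1 (Nat.dvd_of_mem_primeFactors hp)
  have h2 : (n : ℝ) ≤ x := (Nat.le_floor_iff hx).1 hn.2
  have h3 : (p : ℝ) ≤ n := by exact_mod_cast h1
  linarith

theorem half_le_smoothCount {x y : ℝ} (hx : 1 ≤ x) (hxy : x ≤ y) : x / 2 ≤ smoothCount x y := by
  rw [smoothCount_eq_floor (by linarith) hxy]
  have h1 := Nat.lt_floor_add_one x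
  have h2 : (1 : ℝ) ≤ ⌊x⌋₊ := by exact_mod_cast (Nat.one_le_floor_iff x).2 hx
  linarith

theorem smoothCount_div_le {x y : ℝ} (hx : 0 ≤ x) {p : ℕ} (hp : p.Prime) (hpy : (p : ℝ) ≤ y) :
    smoothCount (x / p) y ≤ (((Icc 1 ⌊x⌋₊).filter
      (fun n => ∀ p : ℕ, p ∈ n.primeFactors → (p : ℝ) ≤ y)).filter (fun n => p ∣ n)).card := by
  have hp0 : (0 : ℝ) < p := by exact_mod_cast hp.pos
  refine card_le_card_of_injOn (fun m => p * m) (fun m hm => ?_)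
    fun a _ b _ h => Nat.eq_of_mul_eq_mul_left hp.pos h
  simp only [coe_filter, mem_Icc, Set.mem_ofPred_eq, mem_filter] at hm ⊢
  obtain ⟨⟨h1, h2⟩, h3⟩ := hm
  refine ⟨⟨⟨Nat.mul_pos hp.pos h1, ?_⟩, ?_⟩, dvd_mul_right _ _⟩
  · rw [Nat.le_floor_iff (by positivity), le_div_iff₀ hp0] at h2
    rw [Nat.le_floor_iff hx]
    push_cast
    linarith
  · intro q hq
    rw [Nat.primeFactors_mul hp.ne_zero (by omega), mem_union, hp.primeFactors,
      mem_singleton] at hq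
    rcases hq with rfl | hq
    · exact hpy
    · exact h3 q hq

theorem card_filter_dvd_mul_log_le {a b : ℝ} (ha : 0 < a) (hb : 0 ≤ b) {n : ℕ} (hn : n ≠ 0) :
    ((primesBetween a b).filter (fun p => p ∣ n)).card * log a ≤ log n := by
  have hsub : (primesBetween a b).filter (fun p => p ∣ n) ⊆ n.primeFactors := by
    intro p hp
    rw [mem_filter, mem_primesBetween hb] at hp
    exact Nat.mem_primeFactors.2 ⟨hp.1.1, hp.2, hn⟩
  have h1 : a ^ ((primesBetween a b).filter (fun p => p ∣ n)).card ≤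
      ∏ p ∈ (primesBetween a b).filter (fun p => p ∣ n), (p : ℝ) := by
    rw [← prod_const]
    refine prod_le_prod (fun _ _ => ha.le) fun p hp => ?_
    rw [mem_filter, mem_primesBetween hb] at hp
    exact hp.1.2.1.le
  have h2 : ∏ p ∈ (primesBetween a b).filter (fun p => p ∣ n), p ≤ n :=
    Nat.le_of_dvd (Nat.pos_of_ne_zero hn)
      ((prod_dvd_prod_of_subset _ _ _ hsub).trans (Nat.prod_primeFactors_dvd n))
  rw [← log_pow]
  refine log_le_log (by positivity) (h1.trans ?_)
  rw [← Nat.cast_prod]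
  exact Nat.cast_le.2 h2

theorem sum_smoothCount_div_mul_log_le {x a y : ℝ} (hx : 1 ≤ x) (ha : 1 ≤ a) (hy : 0 ≤ y) :
    (∑ p ∈ primesBetween a y, (smoothCount (x / p) y : ℝ)) * log a ≤
      log x * smoothCount x y := by
  set S := (Icc 1 ⌊x⌋₊).filter (fun n => ∀ p : ℕ, p ∈ n.primeFactors → (p : ℝ) ≤ y) with hS
  have hSc : smoothCount x y = S.card := rfl
  have hla : 0 ≤ log a := log_nonneg ha
  have h1 : ∑ p ∈ primesBetween a y, smoothCount (x / p) y ≤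
      ∑ n ∈ S, ((primesBetween a y).filter (fun p => p ∣ n)).card := by
    calc ∑ p ∈ primesBetween a y, smoothCount (x / p) y
        ≤ ∑ p ∈ primesBetween a y, (S.filter (fun n => p ∣ n)).card := by
          refine sum_le_sum fun p hp => ?_
          rw [mem_primesBetween hy] at hp
          exact smoothCount_div_le (by linarith) hp.1 hp.2.2
      _ = _ := by
          simp only [card_filter]
          exact sum_comm
  have h2 : (∑ p ∈ primesBetween a y, (smoothCount (x / p) y : ℝ)) ≤
      ∑ n ∈ S, (((primesBetween a y).filter (fun p => p ∣ n)).card : ℝ) := by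
    exact_mod_cast h1
  calc _ ≤ (∑ n ∈ S, (((primesBetween a y).filter (fun p => p ∣ n)).card : ℝ)) * log a := by
        gcongr
    _ = ∑ n ∈ S, (((primesBetween a y).filter (fun p => p ∣ n)).card : ℝ) * log a := by
        rw [sum_mul]
    _ ≤ ∑ n ∈ S, log x := by
        refine sum_le_sum fun n hn => ?_
        rw [hS, mem_filter, mem_Icc, Nat.le_floor_iff (by linarith)] at hn
        refine (card_filter_dvd_mul_log_le (by linarith) hy (by omega)).trans ?_
        exact log_le_log (by exact_mod_cast hn.1.1) hn.1.2
    _ = log x * smoothCount x y := by rw [sum_const, hSc, nsmul_eq_mul, mul_comm]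

theorem smoothCount_ge_of_log_le {η c y : ℝ} (hη : 0 < η) (hη1 : η < 1) (hc : 0 < c)
    (hy : 2 ≤ y) (h : c ≤ ∑ p ∈ primesBetween (y ^ (1 - η)) y, (1 : ℝ) / p) (n : ℕ) :
    ∀ x : ℝ, 1 ≤ x → log x ≤ (1 + n * (1 - η)) * log y →
      x / 2 * (min 1 (c * (1 - η)) / (n + 1)) ^ n ≤ smoothCount x y := by
  have hy0 : 0 < y := by linarith
  have hL : 0 < log y := log_pos (by linarith)
  have h1η : 0 < 1 - η := by linarith
  set c' := min 1 (c * (1 - η)) with hc'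
  have hc'0 : 0 < c' := lt_min one_pos (by positivity)
  have hc'1 : c' ≤ 1 := min_le_left _ _
  have hc'2 : c' ≤ c * (1 - η) := min_le_right _ _
  induction n with
  | zero =>
    intro x hx hxy
    have : x ≤ y := by
      rw [← log_le_log_iff (by linarith) hy0]; simpa using hxy
    simpa using half_le_smoothCount hx this
  | succ n ih =>
    intro x hx hxy
    push_cast at hxy ⊢
    have hx0 : 0 < x := by linarith
    rcases le_total x y with hxy' | hxy'
    · refine le_trans ?_ (half_le_smoothCount hx hxy')
      have : (c' / (n + 1 + 1)) ^ (n + 1) ≤ 1 := by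
        refine pow_le_one₀ (by positivity) ?_
        rw [div_le_one (by positivity)]
        have : (0 : ℝ) ≤ n := by positivity
        linarith
      nlinarith
    · have ha : 1 ≤ y ^ (1 - η) := one_le_rpow (by linarith) h1η.le
      have hbuch := sum_smoothCount_div_mul_log_le hx ha hy0.le
      rw [log_rpow hy0] at hbuch
      have hterm : ∀ p ∈ primesBetween (y ^ (1 - η)) y,
          x / 2 * (c' / (n + 1 + 1)) ^ n * ((1 : ℝ) / p) ≤ smoothCount (x / p) y := by
        intro p hp
        rw [mem_primesBetween hy0.le] at hp
        have hp0 : (0 : ℝ) < p := by linarith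
        have h1 := ih (x / p) (by rw [one_le_div hp0]; linarith) (by
          have : (1 - η) * log y ≤ log p := by
            rw [← log_rpow hy0]; exact log_le_log (by positivity) hp.2.1.le
          rw [log_div hx0.ne' hp0.ne']
          linarith)
        refine le_trans ?_ h1
        have : (c' / (n + 1 + 1)) ^ n ≤ (c' / (n + 1)) ^ n := by
          gcongr
          linarith
        calc x / 2 * (c' / (n + 1 + 1)) ^ n * ((1 : ℝ) / p)
            = x / p / 2 * (c' / (n + 1 + 1)) ^ n := by ring
          _ ≤ _ := by gcongr
      have hsum := sum_le_sum hterm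
      rw [← mul_sum] at hsum
      set A := x / 2 * (c' / (n + 1 + 1)) ^ n with hA
      have hA0 : 0 < A := by positivity
      have h2 : A * c * ((1 - η) * log y) ≤ log x * smoothCount x y := by
        refine le_trans ?_ hbuch
        gcongr
        refine le_trans ?_ hsum
        gcongr
      have h3 : log x * smoothCount x y ≤ ((n + 1 + 1) * log y) * smoothCount x y := by
        gcongr
        refine hxy.trans (mul_le_mul_of_nonneg_right ?_ hL.le)
        have : (0 : ℝ) ≤ n := by positivity
        nlinarith
      have h4 : A * (c * (1 - η)) ≤ (n + 1 + 1) * smoothCount x y := by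
        have := h2.trans h3
        refine le_of_mul_le_mul_right ?_ hL
        linarith
      have h5 : A * c' ≤ (n + 1 + 1) * smoothCount x y := by
        refine le_trans ?_ h4
        gcongr
      rw [pow_succ, ← mul_assoc, ← hA, ← mul_div_assoc, div_le_iff₀ (by positivity)]
      linarith

theorem exists_lower_exponent_bound {δ c : ℝ} (hδ : 0 < δ) (hc : 0 < c) (hc1 : c ≤ 1) {η : ℝ}
    (hη : 0 < η) (hη1 : η < 1) (hηδ : 1 / (1 - η) ≤ 1 + δ / 2) :
    ∃ u₀ : ℝ, 1 ≤ u₀ ∧ ∀ u, u₀ ≤ u →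
      u ^ (-((1 + δ) * u)) ≤ 1 / 2 * (c / (⌊u / (1 - η)⌋₊ + 1)) ^ ⌊u / (1 - η)⌋₊ := by
  set B := (2 + δ / 2) / c with hB
  have e1 := tendsto_log_atTop.eventually_ge_atTop (2 / δ * ((1 + δ / 2) * log B + log 2))
  obtain ⟨u₀, hu₀⟩ := eventually_atTop.1 e1
  refine ⟨max 1 u₀, le_max_left _ _, fun u hu => ?_⟩
  have hu1 : 1 ≤ u := (le_max_left _ _).trans hu
  have hu0 : 0 < u := by linarith
  have h1 := hu₀ u ((le_max_right _ _).trans hu)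
  have h1η : 0 < 1 - η := by linarith
  set n := ⌊u / (1 - η)⌋₊
  have hn : (n : ℝ) ≤ (1 + δ / 2) * u := by
    refine (Nat.floor_le (by positivity)).trans ?_
    rw [div_eq_mul_one_div, mul_comm]
    gcongr
  have hn1 : (n + 1) / c ≤ B * u := by
    rw [hB, div_mul_eq_mul_div]
    gcongr
    linarith
  have hB1 : 1 ≤ B := by
    rw [hB, one_le_div hc]; linarith
  have hlogn : log ((n + 1) / c) ≤ log B + log u := by
    rw [← log_mul (by positivity) hu0.ne']
    exact log_le_log (by positivity) hn1
  have hlB : 0 ≤ log B := log_nonneg hB1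
  have hlu : 0 ≤ log u := log_nonneg hu1
  have hl2 : 0 < log 2 := log_pos one_lt_two
  rw [← log_le_log_iff (by positivity) (by positivity), log_rpow hu0,
    log_mul (by positivity) (by positivity), log_pow, one_div, log_inv,
    ← inv_div, log_inv]
  have h2 : n * log ((n + 1) / c) ≤ (1 + δ / 2) * u * (log B + log u) := by
    calc n * log ((n + 1) / c) ≤ n * (log B + log u) := by gcongr
      _ ≤ _ := by gcongr
  have h3 : (1 + δ / 2) * log B + log 2 ≤ δ / 2 * log u := by
    have : δ / 2 * (2 / δ * ((1 + δ / 2) * log B + log 2)) = (1 + δ / 2) * log B + log 2 := by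
      field_simp
    rw [← this]
    gcongr
  have h4 : u * ((1 + δ / 2) * log B + log 2) ≤ u * (δ / 2 * log u) := by gcongr
  nlinarith

theorem exists_smoothCount_lower {δ : ℝ} (hδ : 0 < δ) :
    ∃ u₀ y₀ : ℝ, ∀ x y : ℝ, 2 ≤ x → 2 ≤ y → y₀ ≤ y → u₀ ≤ log x / log y →
      x * (log x / log y) ^ (-((1 + δ) * (log x / log y))) ≤ smoothCount x y := by
  set η := δ / 2 / (1 + δ / 2) with hη
  have hη0 : 0 < η := by positivity
  have h1η : 1 - η = 1 / (1 + δ / 2) := by rw [hη]; field_simp; ring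
  have hη1 : η < 1 := by
    have : 0 < 1 - η := by rw [h1η]; positivity
    linarith
  obtain ⟨y₀, hy₀⟩ := exists_le_sum_primesBetween hη0 hη1
  have hc : 0 < min 1 (η / 16 * (1 - η)) :=
    lt_min one_pos (mul_pos (by positivity) (by linarith))
  obtain ⟨u₀, hu₀, h⟩ := exists_lower_exponent_bound hδ hc (min_le_left _ _) hη0 hη1
    (by rw [h1η, one_div_one_div])
  refine ⟨u₀, y₀, fun x y hx hy hy' hu => ?_⟩
  have hL : 0 < log y := log_pos (by linarith)
  set u := log x / log y with hu_def
  have hxu : log x = u * log y := by rw [hu_def]; field_simp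
  have h1 := smoothCount_ge_of_log_le hη0 hη1 (by positivity) hy (hy₀ y hy') ⌊u / (1 - η)⌋₊ x
    (by linarith) (by
      rw [hxu]
      gcongr
      have := Nat.lt_floor_add_one (u / (1 - η))
      rw [div_lt_iff₀ (by linarith)] at this
      linarith)
  refine le_trans ?_ h1
  have := mul_le_mul_of_nonneg_left (h u hu) (show 0 ≤ x by linarith)
  linarith

theorem sum_primesLE_log_div_le (N : ℕ) :
    ∑ p ∈ Nat.primesLE N, log p / p ≤ 2 * log N := by
  rcases Nat.eq_zero_or_pos N with rfl | hN
  · simp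
  have hN0 : (0 : ℝ) < N := by exact_mod_cast hN
  have hdvd : ∏ p ∈ Nat.primesLE N, p ^ (N / p) ∣ N.factorial := by
    refine Finset.prod_dvd_of_isRelPrime (fun p hp q hq hpq => ?_) fun p hp => ?_
    · exact Nat.coprime_iff_isRelPrime.1 <| Nat.Coprime.pow _ _ <|
        (Nat.coprime_primes (Nat.prime_of_mem_primesLE hp) (Nat.prime_of_mem_primesLE hq)).2 hpq
    · rw [(Nat.prime_of_mem_primesLE hp).pow_dvd_factorial_iff (Nat.lt_succ_self (Nat.log p N))]
      refine le_trans (by simp) (single_le_sum (f := fun i => N / p ^ i) (fun _ _ => Nat.zero_le _)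
        (mem_Ico.2 ⟨le_rfl, ?_⟩))
      have := Nat.log_pos (Nat.one_lt_of_mem_primesLE hp) (Nat.le_of_mem_primesLE hp)
      omega
  have hle : ∏ p ∈ Nat.primesLE N, p ^ (N / p) ≤ N ^ N :=
    (Nat.le_of_dvd (Nat.factorial_pos N) hdvd).trans (Nat.factorial_le_pow N)
  have hle' : ∏ p ∈ Nat.primesLE N, (p : ℝ) ^ (N / p) ≤ (N : ℝ) ^ N := by exact_mod_cast hle
  have hpos : ∀ p ∈ Nat.primesLE N, (1 : ℝ) < p := fun p hp => by
    exact_mod_cast Nat.one_lt_of_mem_primesLE hp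
  have hlog : ∑ p ∈ Nat.primesLE N, ((N / p : ℕ) : ℝ) * log p ≤ N * log N := by
    rw [← log_pow]
    refine le_trans (le_of_eq ?_) (log_le_log (prod_pos fun p hp => ?_) hle')
    · rw [log_prod fun p hp => by have := hpos p hp; positivity]
      exact sum_congr rfl fun p hp => (log_pow _ _).symm
    · have := hpos p hp
      positivity
  have hterm : ∀ p ∈ Nat.primesLE N, N / 2 * (log p / p) ≤ ((N / p : ℕ) : ℝ) * log p := by
    intro p hp
    have hp1 := hpos p hp
    have hlp : 0 < log p := log_pos hp1
    have h1 : 1 ≤ N / p := (Nat.one_le_div_iff (by exact_mod_cast (by linarith : (0 : ℝ) < p))).2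
      (Nat.le_of_mem_primesLE hp)
    have h1' : (1 : ℝ) ≤ (N / p : ℕ) := by exact_mod_cast h1
    have h2 : (N : ℝ) / p < (N / p : ℕ) + 1 := by
      rw [← Nat.floor_div_eq_div (K := ℝ)]; exact Nat.lt_floor_add_one _
    calc N / 2 * (log p / p) = N / p / 2 * log p := by ring
      _ ≤ _ := by gcongr; linarith
  have := (sum_le_sum hterm).trans hlog
  rw [← mul_sum] at this
  have h3 : (N : ℝ) * ∑ p ∈ Nat.primesLE N, log p / p ≤ N * (2 * log N) := by linarith
  exact le_of_mul_le_mul_left h3 hN0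

theorem sum_Icc_rpow_neg_le {β : ℝ} (hβ : 0 ≤ β) (hβ1 : β < 1) (N : ℕ) :
    ∑ n ∈ Icc 1 N, (n : ℝ) ^ (-β) ≤ (N : ℝ) ^ (1 - β) / (1 - β) := by
  have hσ : 0 < 1 - β := by linarith
  induction N with
  | zero => simp [zero_rpow hσ.ne']
  | succ N ih =>
    rw [sum_Icc_succ_top (by omega)]
    have hN : (0 : ℝ) < ((N + 1 : ℕ) : ℝ) := by positivity
    set M : ℝ := ((N + 1 : ℕ) : ℝ) with hM
    have hNM : (N : ℝ) = M * (1 + -(1 / M)) := by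
      field_simp; rw [hM]; push_cast; ring
    have hM1 : 1 / M ≤ 1 := by
      rw [div_le_one hN, hM]; push_cast; linarith [Nat.cast_nonneg (α := ℝ) N]
    have h1 := rpow_one_add_le_one_add_mul_self (s := -(1 / M)) (by linarith) hσ.le
      (by linarith : 1 - β ≤ 1)
    have h2 : (N : ℝ) ^ (1 - β) ≤ M ^ (1 - β) * (1 + (1 - β) * -(1 / M)) := by
      rw [hNM, mul_rpow hN.le (by linarith)]
      gcongr
    have h3 : M ^ (-β) = M ^ (1 - β) * (1 / M) := by
      rw [show -β = (1 - β) - 1 by ring, rpow_sub_one hN.ne']; ring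
    rw [le_div_iff₀ hσ] at ih ⊢
    rw [add_mul, h3]
    linarith

/-- The completely multiplicative weight equal to `p ^ β` at the primes `p ∈ S` and to `1` at the
other primes. -/
noncomputable def primeWeight (β : ℝ) (S : Finset ℕ) (n : ℕ) : ℝ :=
  ∏ p ∈ S, (p : ℝ) ^ (β * n.factorization p)

theorem primeWeight_nonneg (β : ℝ) (S : Finset ℕ) (n : ℕ) : 0 ≤ primeWeight β S n :=
  prod_nonneg fun _ _ => by positivity

theorem primeWeight_insert {β : ℝ} {S : Finset ℕ} {q : ℕ} (hq : q ∉ S) (n : ℕ) :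
    primeWeight β (insert q S) n = (q : ℝ) ^ (β * n.factorization q) * primeWeight β S n :=
  prod_insert hq

theorem primeWeight_prime_mul {β : ℝ} {S : Finset ℕ} {q : ℕ} (hq : q.Prime) (hqS : q ∉ S)
    {m : ℕ} (hm : m ≠ 0) : primeWeight β S (q * m) = primeWeight β S m := by
  refine prod_congr rfl fun p hp => ?_
  have : p ≠ q := fun h => hqS (h ▸ hp)
  rw [Nat.factorization_mul hq.ne_zero hm, hq.factorization]
  simp [this.symm]

/-- The sum of `n ^ (-β)` over `1 ≤ n ≤ N`, weighted by `primeWeight β S`. -/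
noncomputable def weightedSum (β : ℝ) (S : Finset ℕ) (N : ℕ) : ℝ :=
  ∑ n ∈ Icc 1 N, primeWeight β S n * (n : ℝ) ^ (-β)

theorem weightedSum_insert_sub {β : ℝ} {S : Finset ℕ} {q : ℕ} (hq : q.Prime) (hqS : q ∉ S)
    (N : ℕ) :
    weightedSum β (insert q S) N - weightedSum β S N =
      weightedSum β (insert q S) (N / q) - (q : ℝ) ^ (-β) * weightedSum β S (N / q) := by
  have hq0 : (0 : ℝ) < q := by exact_mod_cast hq.pos
  simp only [weightedSum, mul_sum, ← sum_sub_distrib]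
  rw [← sum_filter_add_sum_filter_not (Icc 1 N) (fun n => q ∣ n)]
  rw [sum_eq_zero (s := (Icc 1 N).filter (fun n => ¬ q ∣ n)), add_zero]
  · symm
    refine sum_nbij' (fun m => q * m) (fun n => n / q) ?_ ?_ ?_ ?_ ?_
    · intro m hm
      rw [mem_Icc, Nat.le_div_iff_mul_le hq.pos] at hm
      rw [mem_filter, mem_Icc]
      exact ⟨⟨Nat.mul_pos hq.pos hm.1, by linarith⟩, dvd_mul_right _ _⟩
    · intro n hn
      rw [mem_filter, mem_Icc] at hn
      rw [mem_Icc]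
      exact ⟨Nat.div_pos (Nat.le_of_dvd hn.1.1 hn.2) hq.pos, Nat.div_le_div_right hn.1.2⟩
    · intro m _
      exact Nat.mul_div_cancel_left m hq.pos
    · intro n hn
      exact Nat.mul_div_cancel' (mem_filter.1 hn).2
    · intro m hm
      have hm0 : m ≠ 0 := by have := (mem_Icc.1 hm).1; omega
      rw [primeWeight_insert hqS, primeWeight_insert hqS, primeWeight_prime_mul hq hqS hm0,
        Nat.factorization_mul hq.ne_zero hm0, hq.factorization]
      simp only [Finsupp.add_apply, Finsupp.single_eq_same]
      push_cast
      rw [mul_rpow hq0.le (Nat.cast_nonneg m), mul_add, rpow_add hq0, mul_one, rpow_neg hq0.le]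
      field_simp
  · intro n hn
    rw [primeWeight_insert hqS, Nat.factorization_eq_zero_of_not_dvd (mem_filter.1 hn).2]
    simp

theorem weightedSum_insert_le {β B : ℝ} (hβ : 0 ≤ β) (hβ1 : β < 1) (hB : 0 ≤ B) {S : Finset ℕ}
    {q : ℕ} (hq : q.Prime) (hqS : q ∉ S)
    (h : ∀ N : ℕ, weightedSum β S N ≤ B * (N : ℝ) ^ (1 - β)) (N : ℕ) :
    weightedSum β (insert q S) N ≤
      B * (1 + (1 - (q : ℝ) ^ (-β)) * (q : ℝ) ^ (-(1 - β)) / (1 - (q : ℝ) ^ (-(1 - β)))) *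
        (N : ℝ) ^ (1 - β) := by
  have hσ : 0 < 1 - β := by linarith
  have hq1 : (1 : ℝ) < q := by exact_mod_cast hq.one_lt
  have hq0 : (0 : ℝ) < q := by linarith
  set t := (q : ℝ) ^ (-(1 - β)) with ht
  have ht1 : t < 1 := rpow_lt_one_of_one_lt_of_neg hq1 (by linarith)
  have ht0 : 0 < t := by positivity
  set s := (q : ℝ) ^ (-β) with hs
  have hs1 : s ≤ 1 := rpow_le_one_of_one_le_of_nonpos hq1.le (by linarith)
  set K := (1 - s) * t / (1 - t) with hK
  have hK0 : 0 ≤ K := div_nonneg (mul_nonneg (by linarith) ht0.le) (by linarith)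
  have hKt : K * t + (1 - s) * t = K := by
    have : 1 - t ≠ 0 := by linarith
    rw [hK]; field_simp; ring
  have hdiff : ∀ N : ℕ, weightedSum β (insert q S) N - weightedSum β S N ≤
      B * K * (N : ℝ) ^ (1 - β) := by
    intro N
    induction N using Nat.strong_induction_on with
    | _ N ih =>
      rcases Nat.eq_zero_or_pos N with rfl | hN
      · simp [weightedSum, zero_rpow hσ.ne']
      rw [weightedSum_insert_sub hq hqS]
      have h1 := ih (N / q) (Nat.div_lt_self hN hq.one_lt)
      have h2 := mul_le_mul_of_nonneg_left (h (N / q)) (show 0 ≤ 1 - s by linarith)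
      have h3 : ((N / q : ℕ) : ℝ) ^ (1 - β) ≤ (N : ℝ) ^ (1 - β) * t := by
        calc ((N / q : ℕ) : ℝ) ^ (1 - β) ≤ ((N : ℝ) / q) ^ (1 - β) := by
              gcongr; exact Nat.cast_div_le
          _ = _ := by rw [div_rpow (by positivity) hq0.le, ht, rpow_neg hq0.le, div_eq_mul_inv]
      calc _ ≤ B * (K + (1 - s)) * ((N / q : ℕ) : ℝ) ^ (1 - β) := by linarith
        _ ≤ B * (K + (1 - s)) * ((N : ℝ) ^ (1 - β) * t) := by
          refine mul_le_mul_of_nonneg_left h3 (mul_nonneg hB (by linarith))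
        _ = B * (K * t + (1 - s) * t) * (N : ℝ) ^ (1 - β) := by ring
        _ = _ := by rw [hKt]
  have := hdiff N
  have := h N
  linarith

theorem euler_factor_sub_one_nonneg {β : ℝ} (hβ : 0 ≤ β) (hβ1 : β < 1) {p : ℕ} (hp : p.Prime) :
    0 ≤ (1 - (p : ℝ) ^ (-β)) * (p : ℝ) ^ (-(1 - β)) / (1 - (p : ℝ) ^ (-(1 - β))) := by
  have hp1 : (1 : ℝ) < p := by exact_mod_cast hp.one_lt
  have h1 : (p : ℝ) ^ (-β) ≤ 1 := rpow_le_one_of_one_le_of_nonpos hp1.le (by linarith)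
  have h2 : (p : ℝ) ^ (-(1 - β)) < 1 := rpow_lt_one_of_one_lt_of_neg hp1 (by linarith)
  exact div_nonneg (mul_nonneg (sub_nonneg.2 h1) (by positivity)) (sub_nonneg.2 h2.le)

theorem weightedSum_le {β : ℝ} (hβ : 0 ≤ β) (hβ1 : β < 1) (S : Finset ℕ)
    (hS : ∀ p ∈ S, p.Prime) (N : ℕ) :
    weightedSum β S N ≤ 1 / (1 - β) * (∏ p ∈ S, (1 + (1 - (p : ℝ) ^ (-β)) *
      (p : ℝ) ^ (-(1 - β)) / (1 - (p : ℝ) ^ (-(1 - β))))) * (N : ℝ) ^ (1 - β) := by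
  have hσ : 0 < 1 - β := by linarith
  induction S using Finset.induction_on generalizing N with
  | empty =>
    have := sum_Icc_rpow_neg_le hβ hβ1 N
    simp only [weightedSum, primeWeight, prod_empty, one_mul, mul_one]
    linarith [one_div_mul_eq_div (1 - β) ((N : ℝ) ^ (1 - β))]
  | insert q S hq ih =>
    rw [prod_insert hq, mul_comm (1 + _) (∏ p ∈ S, _), ← mul_assoc]
    refine weightedSum_insert_le hβ hβ1 ?_ (hS q (mem_insert_self _ _)) hq
      (ih fun p hp => hS p (mem_insert_of_mem hp)) N
    refine mul_nonneg (by positivity) (prod_nonneg fun p hp => ?_)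
    linarith [euler_factor_sub_one_nonneg hβ hβ1 (hS p (mem_insert_of_mem hp))]

theorem smoothCount_le_weightedSum (β x y : ℝ) :
    smoothCount x y ≤ weightedSum β (Nat.primesLE ⌊y⌋₊) ⌊x⌋₊ := by
  rw [smoothCount, card_eq_sum_ones]
  push_cast
  refine le_trans (sum_le_sum (g := fun n : ℕ =>
    primeWeight β (Nat.primesLE ⌊y⌋₊) n * (n : ℝ) ^ (-β)) fun n hn => ?_)
    (sum_le_sum_of_subset_of_nonneg (filter_subset _ _) fun n _ _ =>
      mul_nonneg (primeWeight_nonneg _ _ _) (by positivity))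
  rw [mem_filter, mem_Icc] at hn
  have hn0 : n ≠ 0 := by omega
  have hn0' : (0 : ℝ) < n := by exact_mod_cast hn.1.1
  have hsub : n.primeFactors ⊆ Nat.primesLE ⌊y⌋₊ := fun p hp =>
    Nat.mem_primesLE.2 ⟨Nat.le_floor (hn.2 p hp), Nat.prime_of_mem_primeFactors hp⟩
  have h1 : primeWeight β (Nat.primesLE ⌊y⌋₊) n = (n : ℝ) ^ β := by
    rw [primeWeight, ← prod_subset hsub]
    · conv_rhs => rw [← Nat.prod_factorization_pow_eq_self hn0]
      rw [Finsupp.prod, Nat.support_factorization, Nat.cast_prod,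
        ← Real.finsetProd_rpow _ _ fun _ _ => by positivity]
      refine prod_congr rfl fun p _ => ?_
      rw [Nat.cast_pow, ← rpow_natCast, ← rpow_mul (Nat.cast_nonneg p), mul_comm]
    · intro p _ hp
      have : n.factorization p = 0 := by
        rwa [← Finsupp.notMem_support_iff, Nat.support_factorization]
      simp [this]
  rw [h1, ← rpow_add hn0']
  simp

theorem euler_factor_sub_one_le {σ₀ β y : ℝ} (hσ₀ : 0 < σ₀) (hβ : 0 ≤ β) (hβ1 : β ≤ 1 - σ₀)
    {p : ℕ} (hp : p.Prime) (hpy : (p : ℝ) ≤ y) :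
    (1 - (p : ℝ) ^ (-β)) * (p : ℝ) ^ (-(1 - β)) / (1 - (p : ℝ) ^ (-(1 - β))) ≤
      β * y ^ β / (1 - 2 ^ (-σ₀)) * (log p / p) := by
  have hp2 : (2 : ℝ) ≤ p := by exact_mod_cast hp.two_le
  have hp0 : (0 : ℝ) < p := by linarith
  have hlp : 0 ≤ log p := log_nonneg (by linarith)
  have h1 : 1 - (p : ℝ) ^ (-β) ≤ β * log p := by
    rw [rpow_def_of_pos hp0]
    linarith [add_one_le_exp (log p * -β)]
  have h2 : (p : ℝ) ^ (-(1 - β)) ≤ y ^ β / p := by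
    rw [show -(1 - β) = β - 1 by ring, rpow_sub_one hp0.ne']
    gcongr
  have h3 : (p : ℝ) ^ (-(1 - β)) ≤ 2 ^ (-σ₀) :=
    (rpow_le_rpow_of_nonpos (by norm_num) hp2 (by linarith)).trans
      (rpow_le_rpow_of_exponent_le (by norm_num) (by linarith))
  have h4 : (2 : ℝ) ^ (-σ₀) < 1 := rpow_lt_one_of_one_lt_of_neg (by norm_num) (by linarith)
  have hy0 : 0 ≤ y := by linarith
  calc _ ≤ (β * log p) * (y ^ β / p) / (1 - 2 ^ (-σ₀)) := by
        refine div_le_div₀ (by positivity) ?_ (by linarith) (by linarith)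
        exact mul_le_mul h1 h2 (by positivity) (by positivity)
    _ = _ := by ring

theorem smoothCount_le_exp {σ₀ β x y : ℝ} (hσ₀ : 0 < σ₀) (hβ : 0 ≤ β) (hβ1 : β ≤ 1 - σ₀)
    (hx : 1 ≤ x) (hy : 2 ≤ y) :
    smoothCount x y ≤
      1 / σ₀ * exp (2 / (1 - 2 ^ (-σ₀)) * (β * y ^ β * log y)) * x ^ (1 - β) := by
  have hy0 : 0 ≤ y := by linarith
  have h4 : (2 : ℝ) ^ (-σ₀) < 1 := rpow_lt_one_of_one_lt_of_neg (by norm_num) (by linarith)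
  have h4' : 0 < 1 - (2 : ℝ) ^ (-σ₀) := by linarith
  have hprod : ∏ p ∈ Nat.primesLE ⌊y⌋₊, (1 + (1 - (p : ℝ) ^ (-β)) *
      (p : ℝ) ^ (-(1 - β)) / (1 - (p : ℝ) ^ (-(1 - β)))) ≤
      exp (2 / (1 - 2 ^ (-σ₀)) * (β * y ^ β * log y)) := by
    calc _ ≤ ∏ p ∈ Nat.primesLE ⌊y⌋₊,
          exp (β * y ^ β / (1 - 2 ^ (-σ₀)) * (log p / p)) := by
          refine prod_le_prod (fun p hp => ?_) fun p hp => ?_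
          · have := euler_factor_sub_one_nonneg hβ (by linarith) (Nat.prime_of_mem_primesLE hp)
            linarith
          · rw [Nat.mem_primesLE, Nat.le_floor_iff hy0] at hp
            have := euler_factor_sub_one_le hσ₀ hβ hβ1 hp.2 hp.1
            linarith [add_one_le_exp (β * y ^ β / (1 - 2 ^ (-σ₀)) * (log p / p))]
      _ = exp (β * y ^ β / (1 - 2 ^ (-σ₀)) * ∑ p ∈ Nat.primesLE ⌊y⌋₊, log p / p) := by
          rw [← exp_sum, mul_sum]
      _ ≤ exp (β * y ^ β / (1 - 2 ^ (-σ₀)) * (2 * log y)) := by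
          have hfl : (0 : ℝ) < ⌊y⌋₊ := by
            exact_mod_cast Nat.floor_pos.2 (by linarith)
          gcongr
          refine (sum_primesLE_log_div_le _).trans ?_
          gcongr
          exact Nat.floor_le hy0
      _ = _ := by congr 1; ring
  refine (smoothCount_le_weightedSum β x y).trans
    ((weightedSum_le hβ (by linarith) _ (fun p => Nat.prime_of_mem_primesLE) _).trans ?_)
  have hσ : 0 < 1 - β := by linarith
  have hfl : (⌊x⌋₊ : ℝ) ≤ x := Nat.floor_le (by linarith)
  have hσ₀' : 1 / (1 - β) ≤ 1 / σ₀ := one_div_le_one_div_of_le hσ₀ (by linarith)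
  exact mul_le_mul (mul_le_mul hσ₀' hprod (prod_nonneg fun p hp => by
      linarith [euler_factor_sub_one_nonneg hβ (by linarith) (Nat.prime_of_mem_primesLE hp)])
    (by positivity)) (by gcongr) (by positivity) (by positivity)

theorem exists_upper_exponent_bound {δ σ₀ : ℝ} (hδ : 0 < δ) (hσ₀ : 0 < σ₀) (C : ℝ) :
    ∃ u₀ : ℝ, 1 ≤ u₀ ∧ ∀ u, u₀ ≤ u →
      1 / σ₀ * exp (C * (log u * u ^ (1 - δ / 2))) * u ^ (-((1 - δ / 2) * u)) ≤
        u ^ (-((1 - δ) * u)) := by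
  have e1 := tendsto_log_atTop.eventually_ge_atTop 1
  have e2 := (tendsto_rpow_atTop (y := δ / 2) (by linarith)).eventually_ge_atTop (4 * C / δ)
  obtain ⟨u₀, hu₀⟩ := eventually_atTop.1
    (e1.and (e2.and (eventually_ge_atTop (4 / δ * log (1 / σ₀)))))
  refine ⟨max 1 u₀, le_max_left _ _, fun u hu => ?_⟩
  have hu1 : 1 ≤ u := (le_max_left _ _).trans hu
  have hu0 : 0 < u := by linarith
  obtain ⟨h1, h2, h3⟩ := hu₀ u ((le_max_right _ _).trans hu)
  rw [← log_le_log_iff (by positivity) (by positivity), log_mul (by positivity) (by positivity),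
    log_mul (by positivity) (by positivity), log_exp, log_rpow hu0, log_rpow hu0]
  have h4 : C * (log u * u ^ (1 - δ / 2)) ≤ δ / 4 * (u * log u) := by
    have h5 : C ≤ δ / 4 * u ^ (δ / 2) := by
      rw [div_le_iff₀ hδ] at h2; linarith
    calc C * (log u * u ^ (1 - δ / 2)) ≤
          δ / 4 * u ^ (δ / 2) * (log u * u ^ (1 - δ / 2)) := by
          refine mul_le_mul_of_nonneg_right h5 (by positivity)
      _ = δ / 4 * (u ^ (δ / 2) * u ^ (1 - δ / 2) * log u) := by ring
      _ = δ / 4 * (u * log u) := by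
          rw [← rpow_add hu0]; congr 3; rw [add_sub_cancel, rpow_one]
  have h6 : log (1 / σ₀) ≤ δ / 4 * (u * log u) := by
    calc log (1 / σ₀) = δ / 4 * (4 / δ * log (1 / σ₀)) := by field_simp
      _ ≤ δ / 4 * u := by gcongr
      _ ≤ _ := by gcongr; nlinarith
  linarith

theorem exists_smoothCount_upper {ε δ : ℝ} (hε : 0 < ε) (hδ : 0 < δ) (hδ1 : δ ≤ 1) :
    ∃ u₀ : ℝ, 1 ≤ u₀ ∧ ∀ x y : ℝ, 2 ≤ x → 3 ≤ y → log x ^ (1 + ε) ≤ y →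
      u₀ ≤ log x / log y →
      smoothCount x y ≤ x * (log x / log y) ^ (-((1 - δ) * (log x / log y))) := by
  set σ₀ := ε / (1 + ε) with hσ₀_def
  have hσ₀ : 0 < σ₀ := by positivity
  have h4 : (2 : ℝ) ^ (-σ₀) < 1 := rpow_lt_one_of_one_lt_of_neg (by norm_num) (by linarith)
  obtain ⟨u₀, hu₀, h⟩ := exists_upper_exponent_bound hδ hσ₀
    (2 / (1 - 2 ^ (-σ₀)))
  refine ⟨u₀, hu₀, fun x y hx hy hxy hu => ?_⟩
  have hx0 : 0 < x := by linarith
  have hy0 : 0 < y := by linarith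
  have hL1 : 1 ≤ log y := by
    rw [le_log_iff_exp_le hy0]; linarith [exp_one_lt_three]
  have hlx : 0 < log x := log_pos (by linarith)
  set u := log x / log y with hu_def
  have hu1 : 1 ≤ u := by linarith
  have hu0 : 0 < u := by linarith
  have hxu : log x = u * log y := by rw [hu_def]; field_simp
  have hlu0 : 0 ≤ log u := log_nonneg hu1
  have hlu : log u ≤ log y * (1 - σ₀) := by
    have h1 : log u ≤ log (log x) := log_le_log hu0 (by rw [hxu]; nlinarith)
    have h2 : (1 + ε) * log (log x) ≤ log y := by
      rw [← log_rpow hlx]; exact log_le_log (by positivity) hxy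
    have h3 : 1 - σ₀ = 1 / (1 + ε) := by rw [hσ₀_def]; field_simp; ring
    rw [h3, mul_one_div, le_div_iff₀ (by positivity)]
    nlinarith
  set β := (1 - δ / 2) * log u / log y with hβ_def
  have hβL : β * log y = (1 - δ / 2) * log u := by rw [hβ_def]; field_simp
  have hβ0 : 0 ≤ β := div_nonneg (mul_nonneg (by linarith) hlu0) (by linarith)
  have hβ1 : β ≤ 1 - σ₀ := by
    rw [hβ_def, div_le_iff₀ (by linarith)]
    nlinarith
  have hyβ : y ^ β = u ^ (1 - δ / 2) := by
    rw [rpow_def_of_pos hy0, rpow_def_of_pos hu0, mul_comm, hβL, mul_comm]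
  have hxβ : x ^ (1 - β) = x * u ^ (-((1 - δ / 2) * u)) := by
    rw [sub_eq_add_neg, rpow_add hx0, rpow_one, rpow_def_of_pos hx0, rpow_def_of_pos hu0, hxu]
    congr 2
    linear_combination -u * hβL
  have hmain := smoothCount_le_exp hσ₀ hβ0 hβ1 (x := x) (y := y) (by linarith) (by linarith)
  refine hmain.trans ?_
  have h5 : β * y ^ β * log y ≤ log u * u ^ (1 - δ / 2) := by
    rw [hyβ, mul_right_comm, hβL]
    gcongr
    nlinarith
  have h6 : exp (2 / (1 - 2 ^ (-σ₀)) * (β * y ^ β * log y)) ≤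
      exp (2 / (1 - 2 ^ (-σ₀)) * (log u * u ^ (1 - δ / 2))) :=
    exp_le_exp.2 (mul_le_mul_of_nonneg_left h5 (div_nonneg two_pos.le (by linarith)))
  calc _ ≤ 1 / σ₀ * exp (2 / (1 - 2 ^ (-σ₀)) * (log u * u ^ (1 - δ / 2))) * x ^ (1 - β) := by
        gcongr
    _ = x * (1 / σ₀ * exp (2 / (1 - 2 ^ (-σ₀)) * (log u * u ^ (1 - δ / 2))) *
          u ^ (-((1 - δ / 2) * u))) := by rw [hxβ]; ring
    _ ≤ _ := mul_le_mul_of_nonneg_left (h u hu) hx0.le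

end SmoothCount

/-- Canfield–Erdős–Pomerance bound. -/
theorem canfield_erdos_pomerance :
    ∀ ε : ℝ, 0 < ε → ∀ δ : ℝ, 0 < δ → ∃ u₀ : ℝ, ∀ x y : ℝ, 2 ≤ x → 2 ≤ y →
      (Real.log x) ^ (1 + ε) ≤ y → u₀ ≤ Real.log x / Real.log y →
      x * (Real.log x / Real.log y) ^ (-((1 + δ) * (Real.log x / Real.log y))) ≤
          (smoothCount x y : ℝ) ∧
        (smoothCount x y : ℝ) ≤
          x * (Real.log x / Real.log y) ^ (-((1 - δ) * (Real.log x / Real.log y))) := by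
  intro ε hε δ hδ
  obtain ⟨u₁, y₁, hlow⟩ := exists_smoothCount_lower hδ
  obtain ⟨u₂, hu₂, hup⟩ := exists_smoothCount_upper hε (lt_min hδ one_pos) (min_le_right δ 1)
  refine ⟨max (max u₁ u₂) (max y₁ 3 / Real.log 2), fun x y hx hy hxy hu => ?_⟩
  have hu1 : u₁ ≤ Real.log x / Real.log y := ((le_max_left _ _).trans (le_max_left _ _)).trans hu
  have hu2 : u₂ ≤ Real.log x / Real.log y := ((le_max_right _ _).trans (le_max_left _ _)).trans hu
  have hu3 : max y₁ 3 / Real.log 2 ≤ Real.log x / Real.log y := (le_max_right _ _).trans hu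
  have hl2 : 0 < Real.log 2 := Real.log_pos one_lt_two
  have hL2 : Real.log 2 ≤ Real.log y := Real.log_le_log two_pos hy
  have hlx : max y₁ 3 ≤ Real.log x := by
    have h0 : (0 : ℝ) ≤ max y₁ 3 := by linarith [le_max_right y₁ 3]
    calc max y₁ 3 = max y₁ 3 / Real.log 2 * Real.log 2 := by field_simp
      _ ≤ Real.log x / Real.log y * Real.log y :=
        mul_le_mul hu3 hL2 hl2.le ((div_nonneg h0 hl2.le).trans hu3)
      _ = Real.log x := div_mul_cancel₀ _ (by linarith)
  have hlx3 : 3 ≤ Real.log x := (le_max_right _ _).trans hlx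
  have hxy' : Real.log x ≤ y := by
    refine le_trans ?_ hxy
    exact Real.self_le_rpow_of_one_le (by linarith) (by linarith)
  refine ⟨hlow x y hx hy (by linarith [le_max_left y₁ 3]) hu1,
    (hup x y hx (by linarith) hxy hu2).trans ?_⟩
  have hu0 : 1 ≤ Real.log x / Real.log y := hu₂.trans hu2
  gcongr
  exact min_le_left δ 1
end

section
/- (Rankin's bound) For all real numbers x ≥ 1, y ≥ 2 and every real c > 0, one has ψ(x,y) ≤ x^c · ∏_{p ≤ y, p prime} (1 - p^{-c})^{-1}. -/
open scoped Classical

/-- The finite Euler product of `n ↦ n ^ (-c)` over primes in `s` is the sum over the natural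
numbers all of whose prime factors lie in `s`. -/
theorem hasSum_factoredNumbers_rpow_neg {c : ℝ} (hc : 0 < c) (s : Finset ℕ) :
    HasSum (fun m : Nat.factoredNumbers s => ((m : ℕ) : ℝ) ^ (-c))
      (∏ p ∈ s.filter Nat.Prime, (1 - (p : ℝ) ^ (-c))⁻¹) := by
  let f : ℕ →* ℝ :=
    { toFun := fun n => (n : ℝ) ^ (-c)
      map_one' := by simp
      map_mul' := fun m n => by
        push_cast
        exact Real.mul_rpow m.cast_nonneg n.cast_nonneg }
  have hf : ∀ {p : ℕ}, p.Prime → ‖f p‖ < 1 := fun {p} hp => by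
    change ‖(p : ℝ) ^ (-c)‖ < 1
    rw [Real.norm_of_nonneg (by positivity)]
    exact Real.rpow_lt_one_of_one_lt_of_neg (by exact_mod_cast hp.one_lt) (neg_neg_of_pos hc)
  convert (EulerProduct.summable_and_hasSum_factoredNumbers_prod_filter_prime_geometric hf s).2
    <;> rfl

/-- Rankin's bound: ψ(x,y) ≤ x^c · ∏_{p ≤ y} (1 - p^{-c})⁻¹ for every c > 0. -/
theorem rankin_bound (x y c : ℝ) (hx : 1 ≤ x) (hy : 2 ≤ y) (hc : 0 < c) :
    (smoothCount x y : ℝ) ≤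
      x ^ c * ∏ p ∈ (Finset.Icc 1 ⌊y⌋₊).filter Nat.Prime, (1 - (p : ℝ) ^ (-c))⁻¹ := by
  have hx0 : 0 < x := one_pos.trans_le hx
  have hsum := hasSum_factoredNumbers_rpow_neg hc (Finset.Icc 1 ⌊y⌋₊)
  unfold smoothCount
  set A := (Finset.Icc 1 ⌊x⌋₊).filter (fun n => ∀ p : ℕ, p ∈ n.primeFactors → (p : ℝ) ≤ y)
  have hmem : ∀ n ∈ A, n ∈ Nat.factoredNumbers (Finset.Icc 1 ⌊y⌋₊) := by
    intro n hn
    obtain ⟨hn, hsmooth⟩ := Finset.mem_filter.mp hn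
    refine ⟨by have := (Finset.mem_Icc.mp hn).1; omega, fun p hp => ?_⟩
    exact Finset.mem_Icc.mpr ⟨(Nat.prime_of_mem_primeFactorsList hp).one_le,
      Nat.le_floor (hsmooth p (List.mem_toFinset.mpr hp))⟩
  have hterm : ∀ n ∈ A, 1 ≤ x ^ c * (n : ℝ) ^ (-c) := by
    intro n hn
    obtain ⟨hn1, hnx⟩ := Finset.mem_Icc.mp (Finset.mem_filter.mp hn).1
    have hn0 : (0 : ℝ) < n := by exact_mod_cast hn1
    rw [Real.rpow_neg hn0.le, ← div_eq_mul_inv, one_le_div (by positivity)]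
    exact Real.rpow_le_rpow hn0.le ((Nat.le_floor_iff hx0.le).mp hnx) hc.le
  calc (A.card : ℝ) = ∑ n ∈ A, 1 := by simp
    _ ≤ ∑ n ∈ A, x ^ c * (n : ℝ) ^ (-c) := Finset.sum_le_sum hterm
    _ = x ^ c * ∑ m ∈ A.subtype (· ∈ Nat.factoredNumbers (Finset.Icc 1 ⌊y⌋₊)),
          ((m : ℕ) : ℝ) ^ (-c) := by
        rw [← Finset.mul_sum,
          Finset.sum_subtype_of_mem (fun n : ℕ => (n : ℝ) ^ (-c)) hmem]
    _ ≤ _ := by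
        gcongr
        exact sum_le_hasSum _ (fun m _ => by positivity) hsum
end

section
/- (Lambert series for the Euler totient function) For every complex number q with |q| < 1, the series ∑_{m=1}^{∞} φ(m) q^m / (1 - q^m) converges and equals q/(1-q)². -/
theorem summable_totient_mul_pow_mul {q : ℂ} (hq : ‖q‖ < 1) :
    Summable fun c : ℕ+ × ℕ+ => (Nat.totient c.2 : ℂ) * q ^ (c.1 * c.2 : ℕ) := by
  refine Summable.of_norm_bounded (summable_prod_mul_pow 1 hq).norm fun c => ?_
  rw [norm_mul, norm_mul]
  gcongr
  simpa using Nat.totient_le c.2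

theorem hasSum_pnat_mul_pow {q : ℂ} (hq : ‖q‖ < 1) :
    HasSum (fun n : ℕ+ => (n : ℂ) * q ^ (n : ℕ)) (q / (1 - q) ^ 2) := by
  refine (hasSum_pnat_iff_hasSum_succ (f := fun n : ℕ => (n : ℂ) * q ^ n)).mpr ?_
  rw [hasSum_nat_add_iff (f := fun n : ℕ => (n : ℂ) * q ^ n) 1]
  simpa using hasSum_coe_mul_geometric_of_norm_lt_one hq

theorem hasSum_totient_mul_pow_mul {q : ℂ} (hq : ‖q‖ < 1) :
    HasSum (fun c : ℕ+ × ℕ+ => (Nat.totient c.2 : ℂ) * q ^ (c.1 * c.2 : ℕ))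
      (q / (1 - q) ^ 2) := by
  have hs := (summable_totient_mul_pow_mul hq).hasSum
  have hsigma := (sigmaAntidiagonalEquivProd.hasSum_iff.mpr hs).sigma
    (g := fun n : ℕ+ => (n : ℂ) * q ^ (n : ℕ)) fun n => ?_
  · rwa [hsigma.unique (hasSum_pnat_mul_pow hq)] at hs
  · convert! hasSum_fintype _ using 1
    change _ = ∑ x : (n : ℕ).divisorsAntidiagonal,
      (Nat.totient x.1.2 : ℂ) * q ^ (x.1.1 * x.1.2)
    rw [Finset.univ_eq_attach, (n : ℕ).divisorsAntidiagonal.sum_attach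
      fun x : ℕ × ℕ => (Nat.totient x.2 : ℂ) * q ^ (x.1 * x.2)]
    calc (n : ℂ) * q ^ (n : ℕ)
        = ∑ x ∈ (n : ℕ).divisorsAntidiagonal, (Nat.totient x.2 : ℂ) * q ^ (n : ℕ) := by
          rw [← Finset.sum_mul, Nat.sum_divisorsAntidiagonal' fun _ y => (Nat.totient y : ℂ)]
          exact_mod_cast congrArg (fun k : ℕ => (k : ℂ) * q ^ (n : ℕ)) (Nat.sum_totient n).symm
      _ = _ := Finset.sum_congr rfl fun x hx => by rw [(Nat.mem_divisorsAntidiagonal.mp hx).1]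

theorem hasSum_const_mul_pow_pnat_mul {q : ℂ} (hq : ‖q‖ < 1) (a : ℂ) (m : ℕ+) :
    HasSum (fun d : ℕ+ => a * q ^ (d * m : ℕ)) (a * q ^ (m : ℕ) / (1 - q ^ (m : ℕ))) := by
  have hm : ‖q ^ (m : ℕ)‖ < 1 := by
    rw [norm_pow]
    exact pow_lt_one₀ (norm_nonneg q) hq m.ne_zero
  refine (hasSum_pnat_iff_hasSum_succ (f := fun d : ℕ => a * q ^ (d * (m : ℕ)))).mpr ?_
  rw [div_eq_mul_inv]
  convert! (hasSum_geometric_of_norm_lt_one hm).mul_left (a * q ^ (m : ℕ)) using 2 with d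
  ring

/-- Lambert series of the Euler totient function: for `‖q‖ < 1`,
`∑_{m=1}^∞ φ(m) qᵐ/(1-qᵐ) = q/(1-q)²` (and in particular the series converges). -/
theorem lambert_series_totient (q : ℂ) (hq : ‖q‖ < 1) :
    HasSum (fun m : ℕ => (Nat.totient (m + 1) : ℂ) * q ^ (m + 1) / (1 - q ^ (m + 1)))
      (q / (1 - q) ^ 2) := by
  refine (hasSum_pnat_iff_hasSum_succ (f := fun m : ℕ =>
    (Nat.totient m : ℂ) * q ^ m / (1 - q ^ m))).mp ?_
  have hswap := (Equiv.prodComm ℕ+ ℕ+).hasSum_iff.mpr (hasSum_totient_mul_pow_mul hq)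
  exact hswap.prod_fiberwise fun m => hasSum_const_mul_pow_pnat_mul hq _ m
end

section
/- (Brun–Titchmarsh theorem) There exists a constant C > 0 such that for every integer q ≥ 1, every integer a with gcd(a,q) = 1, and every real x > q, the number π(x;q,a) of primes p ≤ x with p ≡ a (mod q) satisfies π(x;q,a) ≤ C · x / (φ(q) · log(x/q)). -/
open scoped Classical

namespace BoundingSieve

open Finset ArithmeticFunction
open scoped ArithmeticFunction.Moebius

variable (s : BoundingSieve)

/-- The divisors of the sifting product that are at most `Z`. -/
noncomputable def smallDivisors (Z : ℕ) : Finset ℕ := s.prodPrimes.divisors.filter (· ≤ Z)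

/-- The sum of the Selberg terms over the sifting divisors that are at most `Z`. -/
noncomputable def selbergSum (Z : ℕ) : ℝ := ∑ m ∈ s.smallDivisors Z, s.selbergTerms m

/-- The optimal weights of the `Λ²` sieve, supported on divisors that are at most `Z`. -/
noncomputable def selbergWeights (Z : ℕ) (d : ℕ) : ℝ :=
  (s.nu d)⁻¹ * (s.selbergSum Z)⁻¹ * μ d *
    ∑ m ∈ s.smallDivisors Z, if d ∣ m then s.selbergTerms m else 0

variable {s}

theorem mem_smallDivisors {Z m : ℕ} :
    m ∈ s.smallDivisors Z ↔ m ∣ s.prodPrimes ∧ m ≤ Z := by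
  simp [smallDivisors, prodPrimes_ne_zero]

theorem selbergTerms_pos_of_mem {Z m : ℕ} (hm : m ∈ s.smallDivisors Z) :
    0 < s.selbergTerms m :=
  selbergTerms_pos (mem_smallDivisors.mp hm).1

theorem selbergSum_pos {Z : ℕ} (hZ : 1 ≤ Z) : 0 < s.selbergSum Z :=
  sum_pos (fun _ hm ↦ selbergTerms_pos_of_mem hm) ⟨1, mem_smallDivisors.mpr ⟨one_dvd _, hZ⟩⟩

theorem selbergWeights_one {Z : ℕ} (hZ : 1 ≤ Z) : s.selbergWeights Z 1 = 1 := by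
  have h := (s.selbergSum_pos hZ).ne'
  have h1 : s.nu 1 = 1 := s.nu_mult.map_one
  simp only [selbergWeights, h1, one_dvd, if_true, moebius_apply_one]
  rw [← selbergSum]
  simp [h]

theorem abs_selbergWeights_le {Z d : ℕ} (hZ : 1 ≤ Z) (hd : d ∣ s.prodPrimes) :
    |s.selbergWeights Z d| ≤ (s.nu d)⁻¹ := by
  have hS := s.selbergSum_pos hZ
  have hν := nu_pos_of_dvd_prodPrimes hd
  set T := ∑ m ∈ s.smallDivisors Z, if d ∣ m then s.selbergTerms m else 0 with hT
  have hT0 : 0 ≤ T := sum_nonneg fun m hm ↦ by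
    split_ifs
    exacts [(selbergTerms_pos_of_mem hm).le, le_rfl]
  have hTS : T ≤ s.selbergSum Z := sum_le_sum fun m hm ↦ by
    split_ifs
    exacts [le_rfl, (selbergTerms_pos_of_mem hm).le]
  have hμ : |(μ d : ℝ)| ≤ 1 := by exact_mod_cast abs_moebius_le_one
  rw [selbergWeights, ← hT, abs_mul, abs_mul, abs_mul, abs_of_pos (inv_pos.mpr hν),
    abs_of_pos (inv_pos.mpr hS), abs_of_nonneg hT0]
  calc (s.nu d)⁻¹ * (s.selbergSum Z)⁻¹ * |(μ d : ℝ)| * T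
      ≤ (s.nu d)⁻¹ * (s.selbergSum Z)⁻¹ * 1 * s.selbergSum Z := by gcongr
    _ = (s.nu d)⁻¹ := by field_simp

theorem selbergWeights_eq_zero {Z d : ℕ} (hd : Z < d) : s.selbergWeights Z d = 0 := by
  rw [selbergWeights, sum_eq_zero, mul_zero]
  intro m hm
  obtain ⟨hmP, hmZ⟩ := mem_smallDivisors.mp hm
  have hm0 : 0 < m := Nat.pos_of_dvd_of_pos hmP (Nat.pos_of_ne_zero prodPrimes_ne_zero)
  rw [if_neg fun h ↦ (Nat.le_of_dvd hm0 h).not_gt (by lia)]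

/-- Möbius inversion over the divisors of a squarefree number that are multiples of `l`. -/
theorem sum_moebius_multiples {l m : ℕ} (hm : Squarefree m) :
    (∑ d ∈ m.divisors, if l ∣ d then μ d else 0) = if m = l then μ l else 0 := by
  by_cases hlm : l ∣ m
  swap
  · rw [sum_eq_zero fun d hd ↦ if_neg fun h ↦ hlm (h.trans (Nat.dvd_of_mem_divisors hd)),
      if_neg fun h ↦ hlm h.symm.dvd]
  obtain ⟨k, rfl⟩ := hlm
  have hlk := hm.ne_zero
  have hl0 : l ≠ 0 := left_ne_zero_of_mul hlk
  have hk0 : k ≠ 0 := right_ne_zero_of_mul hlk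
  have hcop : l.Coprime k := Nat.coprime_of_squarefree_mul hm
  have himg : (l * k).divisors.filter (l ∣ ·) = k.divisors.image (l * ·) := by
    ext d
    simp only [mem_filter, Nat.mem_divisors, mem_image]
    constructor
    · rintro ⟨⟨h1, -⟩, e, rfl⟩
      exact ⟨e, ⟨Nat.dvd_of_mul_dvd_mul_left (Nat.pos_of_ne_zero hl0) h1, hk0⟩, rfl⟩
    · rintro ⟨e, ⟨he, -⟩, rfl⟩
      exact ⟨⟨mul_dvd_mul_left l he, hlk⟩, dvd_mul_right l e⟩
  rw [← sum_filter, himg, sum_image fun a _ b _ h ↦ Nat.eq_of_mul_eq_mul_left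
    (Nat.pos_of_ne_zero hl0) h]
  have h1 : ∑ e ∈ k.divisors, μ (l * e) = μ l * ∑ e ∈ k.divisors, μ e := by
    rw [mul_sum]
    refine sum_congr rfl fun e he ↦ ?_
    exact isMultiplicative_moebius.map_mul_of_coprime
      (hcop.coprime_dvd_right (Nat.dvd_of_mem_divisors he))
  have h2 : ∑ e ∈ k.divisors, μ e = if k = 1 then 1 else 0 := by
    rw [← coe_mul_zeta_apply, moebius_mul_coe_zeta, one_apply]
  rw [h1, h2]
  have h3 : l * k = l ↔ k = 1 := by simp [hl0]
  simp [h3]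

theorem sum_nu_mul_selbergWeights {Z l : ℕ} :
    (∑ d ∈ s.prodPrimes.divisors, if l ∣ d then s.nu d * s.selbergWeights Z d else 0) =
      if l ∈ s.smallDivisors Z then (s.selbergSum Z)⁻¹ * μ l * s.selbergTerms l else 0 := by
  calc (∑ d ∈ s.prodPrimes.divisors, if l ∣ d then s.nu d * s.selbergWeights Z d else 0)
      = ∑ d ∈ s.prodPrimes.divisors, ∑ m ∈ s.smallDivisors Z, (s.selbergSum Z)⁻¹ *
          (s.selbergTerms m * if d ∣ m then (if l ∣ d then (μ d : ℝ) else 0) else 0) := by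
        refine sum_congr rfl fun d hd ↦ ?_
        have hν := nu_ne_zero (s := s) (Nat.dvd_of_mem_divisors hd)
        rw [selbergWeights, ← mul_sum]
        split_ifs with h
        · rw [mul_sum, mul_sum, mul_sum]
          refine sum_congr rfl fun m _ ↦ ?_
          split_ifs
          · field_simp
          · simp
        · simp
    _ = ∑ m ∈ s.smallDivisors Z, (s.selbergSum Z)⁻¹ * (s.selbergTerms m *
          if m = l then (μ l : ℝ) else 0) := by
        rw [sum_comm]
        refine sum_congr rfl fun m hm ↦ ?_
        have hmP := (mem_smallDivisors.mp hm).1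
        rw [← mul_sum, ← mul_sum, ← sum_filter,
          Nat.divisors_filter_dvd_of_dvd prodPrimes_ne_zero hmP]
        congr 2
        exact_mod_cast sum_moebius_multiples (l := l) (squarefree_of_dvd_prodPrimes hmP)
    _ = _ := by
        simp only [mul_ite, mul_zero, sum_ite_eq']
        split_ifs <;> ring

/-- The optimal weights minimise the quadratic form given by the main sum. -/
theorem mainSum_selbergWeights {Z : ℕ} (hZ : 1 ≤ Z) :
    s.mainSum (lambdaSquared (s.selbergWeights Z)) = (s.selbergSum Z)⁻¹ := by
  have hS := (s.selbergSum_pos hZ).ne'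
  rw [mainSum_lambdaSquared_eq_sum_mul_sum_sq]
  simp_rw [sum_nu_mul_selbergWeights]
  calc _ = ∑ l ∈ s.prodPrimes.divisors, if l ∈ s.smallDivisors Z then
        ((s.selbergSum Z)⁻¹) ^ 2 * s.selbergTerms l else 0 := by
        refine sum_congr rfl fun l hl ↦ ?_
        have hlP := Nat.dvd_of_mem_divisors hl
        have hg := (selbergTerms_pos hlP).ne'
        have hμ : (μ l : ℝ) ^ 2 = 1 := by
          exact_mod_cast moebius_sq_eq_one_of_squarefree (squarefree_of_dvd_prodPrimes hlP)
        split_ifs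
        · rw [mul_pow, mul_pow, hμ]
          field_simp
        · simp
    _ = (s.selbergSum Z)⁻¹ ^ 2 * s.selbergSum Z := by
        rw [← sum_filter, ← mul_sum, selbergSum]
        congr 2
        ext l
        simp only [mem_filter, smallDivisors]
        tauto
    _ = _ := by field_simp

theorem errSum_lambdaSquared_le (w : ℕ → ℝ) {R : ℝ} (hR : ∀ d, d ∣ s.prodPrimes → |s.rem d| ≤ R) :
    s.errSum (lambdaSquared w) ≤ R * (∑ d ∈ s.prodPrimes.divisors, |w d|) ^ 2 := by
  have hR0 : 0 ≤ R := (abs_nonneg _).trans (hR 1 (one_dvd _))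
  calc s.errSum (lambdaSquared w)
      ≤ ∑ d ∈ s.prodPrimes.divisors, (∑ d1 ∈ s.prodPrimes.divisors,
          ∑ d2 ∈ s.prodPrimes.divisors, if d = d1.lcm d2 then |w d1| * |w d2| else 0) * R := by
        refine sum_le_sum fun d hd ↦ ?_
        have hdP := Nat.dvd_of_mem_divisors hd
        have hsub := Nat.divisors_subset_of_dvd prodPrimes_ne_zero hdP
        have hnn (a b : ℕ) : 0 ≤ if d = a.lcm b then |w a| * |w b| else 0 := by
          split_ifs <;> positivity
        refine mul_le_mul ?_ (hR d hdP) (abs_nonneg _)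
          (sum_nonneg fun a _ ↦ sum_nonneg fun b _ ↦ hnn a b)
        calc |lambdaSquared w d|
            ≤ ∑ d1 ∈ d.divisors, ∑ d2 ∈ d.divisors,
                |if d = d1.lcm d2 then w d1 * w d2 else 0| :=
              (abs_sum_le_sum_abs _ _).trans (sum_le_sum fun _ _ ↦ abs_sum_le_sum_abs _ _)
          _ = ∑ d1 ∈ d.divisors, ∑ d2 ∈ d.divisors,
                if d = d1.lcm d2 then |w d1| * |w d2| else 0 := by
              refine sum_congr rfl fun a _ ↦ sum_congr rfl fun b _ ↦ ?_
              split_ifs <;> simp [abs_mul]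
          _ ≤ ∑ d1 ∈ d.divisors, ∑ d2 ∈ s.prodPrimes.divisors,
                if d = d1.lcm d2 then |w d1| * |w d2| else 0 :=
              sum_le_sum fun a _ ↦ sum_le_sum_of_subset_of_nonneg hsub fun b _ _ ↦ hnn a b
          _ ≤ _ := sum_le_sum_of_subset_of_nonneg hsub fun a _ _ ↦ sum_nonneg fun b _ ↦ hnn a b
    _ = R * (∑ d ∈ s.prodPrimes.divisors, |w d|) ^ 2 := by
        rw [← sum_mul, mul_comm, sum_comm, sq, sum_mul]
        congr 1
        refine sum_congr rfl fun a ha ↦ ?_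
        rw [sum_comm, mul_sum]
        refine sum_congr rfl fun b hb ↦ ?_
        rw [sum_ite_eq', if_pos]
        exact Nat.mem_divisors.mpr ⟨Nat.lcm_dvd (Nat.dvd_of_mem_divisors ha)
          (Nat.dvd_of_mem_divisors hb), prodPrimes_ne_zero⟩

theorem nu_le_selbergTerms {l : ℕ} (hl : l ∣ s.prodPrimes) : s.nu l ≤ s.selbergTerms l := by
  rw [selbergTerms_apply]
  refine le_mul_of_one_le_right (nu_pos_of_dvd_prodPrimes hl).le ?_
  refine one_le_prod fun p hp ↦ ?_
  have hp_prime := Nat.prime_of_mem_primeFactors hp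
  have hpP := (Nat.dvd_of_mem_primeFactors hp).trans hl
  exact (one_le_inv₀ (sub_pos.mpr (s.nu_lt_one_of_prime p hp_prime hpP))).mpr
    (by linarith [s.nu_pos_of_prime p hp_prime hpP])

/-- The Selberg sieve with a crude error term. -/
theorem siftedSum_le_of_abs_rem_le {Z : ℕ} (hZ : 1 ≤ Z) {R : ℝ}
    (hR : ∀ d, d ∣ s.prodPrimes → |s.rem d| ≤ R) :
    s.siftedSum ≤ s.totalMass * (s.selbergSum Z)⁻¹ +
      R * (∑ d ∈ s.smallDivisors Z, (s.nu d)⁻¹) ^ 2 := by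
  have hR0 : 0 ≤ R := (abs_nonneg _).trans (hR 1 (one_dvd _))
  refine (siftedSum_le_mainSum_errSum_of_upperMoebius _
    (upperMoebius_lambdaSquared (s.selbergWeights Z) (selbergWeights_one hZ))).trans ?_
  rw [mainSum_selbergWeights hZ]
  refine add_le_add le_rfl ((errSum_lambdaSquared_le _ hR).trans ?_)
  gcongr
  rw [smallDivisors, sum_filter]
  refine sum_le_sum fun d hd ↦ ?_
  split_ifs with h
  · exact abs_selbergWeights_le hZ (Nat.dvd_of_mem_divisors hd)
  · rw [selbergWeights_eq_zero (not_le.mp h), abs_zero]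

end BoundingSieve

namespace Nat

open Finset

/-- The product of the primes up to `Z` that do not divide `q`. -/
noncomputable def coprimePrimorial (q Z : ℕ) : ℕ :=
  ∏ p ∈ (Icc 1 Z).filter (fun p ↦ p.Prime ∧ ¬ p ∣ q), p

theorem squarefree_coprimePrimorial (q Z : ℕ) : Squarefree (coprimePrimorial q Z) := by
  refine Finset.squarefree_prod_of_pairwise_isCoprime (fun p hp r hr hpr ↦ ?_) fun p hp ↦ ?_
  · simp only [coe_filter, Set.mem_ofPred_eq] at hp hr
    exact Nat.coprime_iff_isRelPrime.mp ((Nat.coprime_primes hp.2.1 hr.2.1).mpr hpr)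
  · exact (mem_filter.mp hp).2.1.squarefree

theorem prime_dvd_coprimePrimorial {q Z p : ℕ} (hp : p.Prime) (h : p ∣ coprimePrimorial q Z) :
    p ≤ Z ∧ ¬ p ∣ q := by
  obtain ⟨r, hr, hpr⟩ := (hp.prime.dvd_finsetProd_iff _).mp h
  obtain ⟨hr1, hr2, hr3⟩ := mem_filter.mp hr
  obtain rfl := (Nat.prime_dvd_prime_iff_eq hp hr2).mp hpr
  exact ⟨(mem_Icc.mp hr1).2, hr3⟩

theorem coprime_of_dvd_coprimePrimorial {q Z d : ℕ} (h : d ∣ coprimePrimorial q Z) :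
    d.Coprime q :=
  Nat.coprime_of_dvd fun _ hp hpd hpq ↦ (prime_dvd_coprimePrimorial hp (hpd.trans h)).2 hpq

theorem dvd_coprimePrimorial {q Z t : ℕ} (ht : Squarefree t) (htZ : t ≤ Z) (htq : t.Coprime q) :
    t ∣ coprimePrimorial q Z := by
  rw [← Nat.prod_primeFactors_of_squarefree ht]
  refine prod_dvd_prod_of_subset _ _ _ fun p hp ↦ ?_
  have hpp := Nat.prime_of_mem_primeFactors hp
  have hpt := Nat.dvd_of_mem_primeFactors hp
  refine mem_filter.mpr ⟨mem_Icc.mpr ⟨hpp.one_le,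
    (Nat.le_of_dvd (Nat.pos_of_ne_zero ht.ne_zero) hpt).trans htZ⟩, hpp, fun hpq ↦ ?_⟩
  exact Nat.Prime.not_dvd_one hpp (htq ▸ Nat.dvd_gcd hpt hpq)

theorem sum_powerset_primeFactors_inv_le {q : ℕ} (hq : 0 < q) :
    ∑ T ∈ q.primeFactors.powerset, ∏ p ∈ T, (p : ℝ)⁻¹ ≤ q / φ q := by
  rw [← prod_one_add]
  have hφ : (0 : ℝ) < φ q := by exact_mod_cast Nat.totient_pos.mpr hq
  have hq0 : (0 : ℝ) < q := by exact_mod_cast hq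
  have h : (φ q : ℝ) = q * ∏ p ∈ q.primeFactors, (1 - (p : ℝ)⁻¹) := by
    have := congrArg (Rat.cast : ℚ → ℝ) (Nat.totient_eq_mul_prod_factors q)
    push_cast at this
    exact this
  rw [le_div_iff₀ hφ, h, mul_left_comm, ← prod_mul_distrib]
  refine mul_le_of_le_one_right hq0.le (prod_le_one (fun p hp ↦ ?_) fun p hp ↦ ?_) <;>
  · have hp1 : (1 : ℝ) ≤ p := by exact_mod_cast (Nat.prime_of_mem_primeFactors hp).one_le
    have h1 : (p : ℝ)⁻¹ ≤ 1 := inv_le_one_of_one_le₀ hp1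
    have h0 : 0 ≤ (p : ℝ)⁻¹ := by positivity
    nlinarith

theorem sum_inv_sq_le_two (Z : ℕ) : ∑ b ∈ Icc 1 Z, ((b : ℝ) ^ 2)⁻¹ ≤ 2 := by
  have h := sum_Ioo_inv_sq_le (α := ℝ) 0 (Z + 1)
  have : Ioo 0 (Z + 1) = Icc 1 Z := by ext; simp; lia
  rw [this] at h
  simpa using h

/-- Every positive integer is the product of a square, a squarefree divisor of `q`, and a
squarefree integer coprime to `q`. -/
theorem exists_sq_mul_squarefree_mul_coprime {n q : ℕ} (hn : 0 < n) (hq : 0 < q) :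
    ∃ b t : ℕ, ∃ T ⊆ q.primeFactors, 0 < b ∧ Squarefree t ∧ t.Coprime q ∧
      b ^ 2 * ((∏ p ∈ T, p) * t) = n := by
  obtain ⟨a, b, ha, hb, hab, hsq⟩ := Nat.sq_mul_squarefree_of_pos hn
  obtain ⟨t, ht⟩ := Nat.gcd_dvd_left a q
  have hsq' := hsq
  rw [ht] at hsq'
  have hcop := Nat.coprime_of_squarefree_mul hsq'
  have hk := hsq'.of_mul_left
  refine ⟨b, t, (a.gcd q).primeFactors, Nat.primeFactors_mono (Nat.gcd_dvd_right a q) hq.ne', hb,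
    hsq'.of_mul_right, ?_, ?_⟩
  · have h1 : t.gcd q ∣ a.gcd q := Nat.dvd_gcd
      ((Nat.gcd_dvd_left t q).trans (ht ▸ dvd_mul_left t _)) (Nat.gcd_dvd_right t q)
    exact Nat.eq_one_of_dvd_coprimes hcop h1 (Nat.gcd_dvd_left t q)
  · rw [Nat.prod_primeFactors_of_squarefree hk, ← ht, hab]

theorem log_le_sum_inv_coprimePrimorial {q : ℕ} (hq : 0 < q) (Z : ℕ) :
    Real.log (Z + 1) ≤
      2 * (q / φ q) * ∑ t ∈ (coprimePrimorial q Z).divisors.filter (· ≤ Z), (t : ℝ)⁻¹ := by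
  set D := (coprimePrimorial q Z).divisors.filter (· ≤ Z) with hD
  let I := Icc 1 Z ×ˢ (q.primeFactors.powerset ×ˢ D)
  let f : ℕ × Finset ℕ × ℕ → ℕ := fun x ↦ x.1 ^ 2 * ((∏ p ∈ x.2.1, p) * x.2.2)
  have hsub : Icc 1 Z ⊆ I.image f := by
    intro n hn
    obtain ⟨hn1, hnZ⟩ := mem_Icc.mp hn
    obtain ⟨b, t, T, hT, hb, ht, htq, h⟩ := exists_sq_mul_squarefree_mul_coprime hn1 hq
    have hbn : b ≤ n := Nat.le_of_dvd hn1 (h ▸ (dvd_pow_self b two_ne_zero).mul_right _)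
    have htn : t ≤ n := Nat.le_of_dvd hn1 (h ▸ (dvd_mul_left t _).mul_left _)
    refine mem_image.mpr ⟨(b, T, t), ?_, h⟩
    simp only [I, mem_product, mem_Icc, mem_powerset, hD, mem_filter, Nat.mem_divisors]
    exact ⟨⟨hb, hbn.trans hnZ⟩, hT, ⟨dvd_coprimePrimorial ht (htn.trans hnZ) htq,
      (squarefree_coprimePrimorial q Z).ne_zero⟩, htn.trans hnZ⟩
  calc Real.log (Z + 1) ≤ ∑ n ∈ Icc 1 Z, (n : ℝ)⁻¹ := by
        have h := log_add_one_le_harmonic Z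
        rw [harmonic_eq_sum_Icc] at h
        push_cast at h
        exact h
    _ ≤ ∑ n ∈ I.image f, (n : ℝ)⁻¹ :=
        sum_le_sum_of_subset_of_nonneg hsub fun _ _ _ ↦ by positivity
    _ ≤ ∑ x ∈ I, (f x : ℝ)⁻¹ :=
        sum_image_le_of_nonneg fun _ _ ↦ by positivity
    _ = (∑ b ∈ Icc 1 Z, ((b : ℝ) ^ 2)⁻¹) *
          ((∑ T ∈ q.primeFactors.powerset, ∏ p ∈ T, (p : ℝ)⁻¹) * ∑ t ∈ D, (t : ℝ)⁻¹) := by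
        rw [sum_mul_sum _ D, ← sum_product', sum_mul_sum, ← sum_product']
        refine sum_congr rfl fun x _ ↦ ?_
        simp only [f]
        push_cast
        rw [mul_inv, mul_inv, prod_inv_distrib]
    _ ≤ 2 * ((q / φ q) * ∑ t ∈ D, (t : ℝ)⁻¹) := by
        gcongr
        · exact sum_inv_sq_le_two Z
        · exact sum_powerset_primeFactors_inv_le hq
    _ = _ := by ring

/-- The number of elements of a residue class modulo `r` up to `x` is `x / r` up to a bounded
error. -/
theorem abs_card_modEq_sub_le {x : ℝ} (hx : 0 ≤ x) {r : ℕ} (hr : 0 < r) (v : ℕ) :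
    |(((Icc 1 ⌊x⌋₊).filter (fun n ↦ n ≡ v [MOD r])).card : ℝ) - x / r| ≤ 2 := by
  have h := Nat.Ioc_filter_modEq_card 0 ⌊x⌋₊ hr v
  have hr1 : (1 : ℝ) ≤ r := by exact_mod_cast hr
  have hrQ : (0 : ℚ) < r := by exact_mod_cast hr
  rw [max_eq_left] at h
  swap
  · refine sub_nonneg.mpr (Int.floor_le_floor ?_)
    gcongr
    exact Nat.zero_le _
  have hIoc : Ioc 0 ⌊x⌋₊ = Icc 1 ⌊x⌋₊ := by ext; simp; lia
  rw [hIoc] at h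
  set A : ℚ := (⌊x⌋₊ - v) / r with hA
  set B : ℚ := ((0 : ℕ) - v) / r with hB
  have hAB : (A : ℝ) - B = ⌊x⌋₊ / r := by
    rw [hA, hB]
    push_cast
    ring
  have hcard : (((Icc 1 ⌊x⌋₊).filter (fun n ↦ n ≡ v [MOD r])).card : ℝ) = (⌊A⌋ : ℝ) - ⌊B⌋ := by
    exact_mod_cast congrArg (Int.cast : ℤ → ℝ) h
  have a1 : (⌊A⌋ : ℝ) ≤ A := by exact_mod_cast Int.floor_le A
  have a2 : (A : ℝ) < ⌊A⌋ + 1 := by exact_mod_cast Int.lt_floor_add_one A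
  have b1 : (⌊B⌋ : ℝ) ≤ B := by exact_mod_cast Int.floor_le B
  have b2 : (B : ℝ) < ⌊B⌋ + 1 := by exact_mod_cast Int.lt_floor_add_one B
  have f1 : (⌊x⌋₊ : ℝ) / r ≤ x / r := by
    gcongr
    exact Nat.floor_le hx
  have f2 : x / r ≤ ⌊x⌋₊ / r + 1 := by
    have := Nat.lt_floor_add_one x
    rw [div_add_one (by positivity)]
    gcongr
    linarith
  rw [hcard, abs_le]
  constructor <;> linarith

end Nat

namespace BrunTitchmarsh

open Finset Nat

/-- The sieve that removes from a residue class modulo `q` the multiples of the primes up to `Z`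
that do not divide `q`. -/
noncomputable def residueSieve (q a Z : ℕ) (x : ℝ) : BoundingSieve where
  support := (Icc 1 ⌊x⌋₊).filter (fun n ↦ n ≡ a [MOD q])
  prodPrimes := coprimePrimorial q Z
  prodPrimes_squarefree := squarefree_coprimePrimorial q Z
  weights _ := 1
  weights_nonneg _ := zero_le_one
  totalMass := x / q
  nu := ⟨fun d ↦ (d : ℝ)⁻¹, by simp⟩
  nu_mult := by
    refine ⟨by simp, fun {m n} _ ↦ ?_⟩
    simp [mul_comm]
  nu_pos_of_prime p hp _ := by
    have : (0 : ℝ) < p := by exact_mod_cast hp.pos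
    simpa using this
  nu_lt_one_of_prime p hp _ := by
    have : (1 : ℝ) < p := by exact_mod_cast hp.one_lt
    simpa using inv_lt_one_of_one_lt₀ this

theorem residueSieve_nu (q a Z : ℕ) (x : ℝ) (d : ℕ) :
    (residueSieve q a Z x).nu d = (d : ℝ)⁻¹ := rfl

theorem smallDivisors_residueSieve (q a Z : ℕ) (x : ℝ) :
    (residueSieve q a Z x).smallDivisors Z =
      (coprimePrimorial q Z).divisors.filter (· ≤ Z) := rfl

theorem abs_rem_residueSieve_le {q a Z d : ℕ} {x : ℝ} (hq : 0 < q) (hx : 0 ≤ x)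
    (hd : d ∣ coprimePrimorial q Z) : |(residueSieve q a Z x).rem d| ≤ 2 := by
  have hd0 : 0 < d := Nat.pos_of_dvd_of_pos hd
    (Nat.pos_of_ne_zero (squarefree_coprimePrimorial q Z).ne_zero)
  have hcop := coprime_of_dvd_coprimePrimorial hd
  obtain ⟨v, hv0, hva⟩ := Nat.chineseRemainder hcop 0 a
  have h := abs_card_modEq_sub_le hx (Nat.mul_pos hd0 hq) v
  have hmult : (residueSieve q a Z x).multSum d =
      ((Icc 1 ⌊x⌋₊).filter (fun n ↦ n ≡ v [MOD d * q])).card := by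
    simp only [BoundingSieve.multSum, residueSieve]
    rw [← sum_filter, filter_filter, sum_const, nsmul_eq_mul, mul_one]
    congr 2
    refine filter_congr fun n _ ↦ ?_
    rw [← Nat.modEq_and_modEq_iff_modEq_mul hcop, and_comm]
    refine and_congr ⟨fun hn ↦ ?_, fun hn ↦ ?_⟩
      ⟨fun hn ↦ hn.trans hva.symm, fun hn ↦ hn.trans hva⟩
    · exact ((Nat.modEq_zero_iff_dvd).mpr hn).trans hv0.symm
    · exact (Nat.modEq_zero_iff_dvd).mp (hn.trans hv0)
  rw [BoundingSieve.rem, hmult, residueSieve_nu]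
  convert h using 3
  simp only [residueSieve]
  push_cast
  field_simp

theorem card_primes_le_add_siftedSum (q a Z : ℕ) (x : ℝ) :
    (((Icc 1 ⌊x⌋₊).filter (fun p ↦ p.Prime ∧ p ≡ a [MOD q])).card : ℝ) ≤
      Z + (residueSieve q a Z x).siftedSum := by
  have hsift : (residueSieve q a Z x).siftedSum = (((Icc 1 ⌊x⌋₊).filter
      (fun n ↦ n ≡ a [MOD q] ∧ (coprimePrimorial q Z).Coprime n)).card : ℝ) := by
    change ∑ d ∈ (Icc 1 ⌊x⌋₊).filter (fun n ↦ n ≡ a [MOD q]),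
      (if (coprimePrimorial q Z).Coprime d then (1 : ℝ) else 0) = _
    rw [← sum_filter, filter_filter, sum_const, nsmul_eq_mul, mul_one]
  rw [hsift]
  have hsub : (Icc 1 ⌊x⌋₊).filter (fun p ↦ p.Prime ∧ p ≡ a [MOD q]) ⊆ Icc 1 Z ∪
      (Icc 1 ⌊x⌋₊).filter (fun n ↦ n ≡ a [MOD q] ∧ (coprimePrimorial q Z).Coprime n) := by
    intro p hp
    obtain ⟨hpx, hpp, hpa⟩ := mem_filter.mp hp
    by_cases hpZ : p ≤ Z
    · exact mem_union_left _ (mem_Icc.mpr ⟨hpp.one_le, hpZ⟩)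
    · refine mem_union_right _ (mem_filter.mpr ⟨hpx, hpa, Nat.Coprime.symm ?_⟩)
      exact (Nat.Prime.coprime_iff_not_dvd hpp).mpr
        fun h ↦ hpZ (prime_dvd_coprimePrimorial hpp h).1
  have h := (card_le_card hsub).trans (card_union_le _ _)
  rw [Nat.card_Icc, Nat.add_sub_cancel] at h
  exact_mod_cast h

theorem siftedSum_residueSieve_le {q a Z : ℕ} {x : ℝ} (hq : 0 < q) (hx : 0 ≤ x) (hZ : 1 ≤ Z) :
    (residueSieve q a Z x).siftedSum ≤
      2 * x / (φ q * Real.log (Z + 1)) + 2 * (Z : ℝ) ^ 4 := by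
  have hφ : (0 : ℝ) < φ q := by exact_mod_cast Nat.totient_pos.mpr hq
  have hq0 : (0 : ℝ) < q := by exact_mod_cast hq
  have hlog : 0 < Real.log (Z + 1) := Real.log_pos (by
    have : (1 : ℝ) ≤ Z := by exact_mod_cast hZ
    linarith)
  set s := residueSieve q a Z x with hs
  have hS : Real.log (Z + 1) ≤ 2 * (q / φ q) * s.selbergSum Z := by
    refine (log_le_sum_inv_coprimePrimorial hq Z).trans ?_
    refine mul_le_mul_of_nonneg_left ?_ (by positivity)
    rw [BoundingSieve.selbergSum, ← smallDivisors_residueSieve q a Z x, ← hs]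
    refine sum_le_sum fun t ht ↦ ?_
    rw [← residueSieve_nu q a Z x t, ← hs]
    exact BoundingSieve.nu_le_selbergTerms (BoundingSieve.mem_smallDivisors.mp ht).1
  have hS0 : 0 < s.selbergSum Z := s.selbergSum_pos hZ
  have hsum : ∑ d ∈ s.smallDivisors Z, (s.nu d)⁻¹ ≤ (Z : ℝ) ^ 2 := by
    calc ∑ d ∈ s.smallDivisors Z, (s.nu d)⁻¹
        = ∑ d ∈ s.smallDivisors Z, (d : ℝ) := by simp only [hs, residueSieve_nu, inv_inv]
      _ ≤ ∑ d ∈ Icc 1 Z, (d : ℝ) := by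
        refine sum_le_sum_of_subset_of_nonneg (fun d hd ↦ ?_) fun _ _ _ ↦ by positivity
        obtain ⟨hdP, hdZ⟩ := BoundingSieve.mem_smallDivisors.mp hd
        exact mem_Icc.mpr ⟨Nat.pos_of_dvd_of_pos hdP
          (Nat.pos_of_ne_zero BoundingSieve.prodPrimes_ne_zero), hdZ⟩
      _ ≤ ∑ d ∈ Icc 1 Z, (Z : ℝ) :=
        sum_le_sum fun d hd ↦ by exact_mod_cast (mem_Icc.mp hd).2
      _ = (Z : ℝ) ^ 2 := by simp [sq]
  have hsum0 : 0 ≤ ∑ d ∈ s.smallDivisors Z, (s.nu d)⁻¹ :=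
    sum_nonneg fun d hd ↦ (inv_pos.mpr (BoundingSieve.nu_pos_of_dvd_prodPrimes
      (BoundingSieve.mem_smallDivisors.mp hd).1)).le
  refine (BoundingSieve.siftedSum_le_of_abs_rem_le hZ
    fun d hd ↦ abs_rem_residueSieve_le hq hx hd).trans (add_le_add ?_ ?_)
  · change x / q * _ ≤ _
    rw [← div_eq_mul_inv, div_div, div_le_div_iff₀ (by positivity) (by positivity)]
    have h := mul_le_mul_of_nonneg_left hS (mul_nonneg hx hφ.le)
    calc x * (φ q * Real.log (Z + 1)) = x * φ q * Real.log (Z + 1) := by ring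
      _ ≤ x * φ q * (2 * (q / φ q) * s.selbergSum Z) := h
      _ = 2 * x * (q * s.selbergSum Z) := by field_simp
  · calc 2 * (∑ d ∈ s.smallDivisors Z, (s.nu d)⁻¹) ^ 2 ≤ 2 * ((Z : ℝ) ^ 2) ^ 2 := by gcongr
      _ = 2 * (Z : ℝ) ^ 4 := by ring

end BrunTitchmarsh

/-- The Brun–Titchmarsh theorem: `π(x;q,a) ≤ C·x/(φ(q)·log(x/q))` for `gcd(a,q) = 1`
and `x > q`, where `π(x;q,a)` counts primes `p ≤ x` with `p ≡ a (mod q)`. -/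
theorem brun_titchmarsh :
    ∃ C : ℝ, 0 < C ∧ ∀ q : ℕ, 1 ≤ q → ∀ a : ℕ, Nat.Coprime a q → ∀ x : ℝ, (q : ℝ) < x →
      (((Finset.Icc 1 ⌊x⌋₊).filter (fun p => Nat.Prime p ∧ p ≡ a [MOD q])).card : ℝ) ≤
        C * x / ((Nat.totient q : ℝ) * Real.log (x / q)) := by
  refine ⟨22, by norm_num, fun q hq a _ x hqx ↦ ?_⟩
  have hq0 : (0 : ℝ) < q := by exact_mod_cast hq
  have hx0 : 0 < x := hq0.trans hqx
  have hφ : (0 : ℝ) < Nat.totient q := by exact_mod_cast Nat.totient_pos.mpr hq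
  have hφq : (Nat.totient q : ℝ) ≤ q := by exact_mod_cast Nat.totient_le q
  set y := x / q with hy
  have hy1 : 1 < y := (one_lt_div hq0).mpr hqx
  have hy0 : 0 < y := one_pos.trans hy1
  have hlog : 0 < Real.log y := Real.log_pos hy1
  set u := y ^ (1 / 8 : ℝ) with hu
  have hu1 : 1 ≤ u := Real.one_le_rpow hy1.le (by norm_num)
  have hu8 : u ^ 8 = y := by
    rw [hu, ← Real.rpow_natCast, ← Real.rpow_mul hy0.le]
    norm_num
  have hlogu : Real.log y = 8 * Real.log u := by
    rw [← hu8, Real.log_pow]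
    norm_num
  have hlogu4 : Real.log y ≤ 2 * u ^ 4 := by
    have h := Real.log_le_sub_one_of_pos (show 0 < u ^ 4 by positivity)
    rw [Real.log_pow] at h
    push_cast at h
    linarith
  set Z := ⌊u⌋₊ with hZdef
  have hZ : 1 ≤ Z := Nat.one_le_floor_iff _ |>.mpr hu1
  have hZu : (Z : ℝ) ≤ u := Nat.floor_le (by positivity)
  have huZ : Real.log u ≤ Real.log (Z + 1) :=
    Real.log_le_log (by positivity) (Nat.lt_floor_add_one u).le
  have hmain : 2 * x / (Nat.totient q * Real.log (Z + 1)) ≤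
      16 * x / (Nat.totient q * Real.log y) := by
    have h1 : 0 < Real.log (Z + 1) := by linarith
    rw [div_le_div_iff₀ (by positivity) (by positivity)]
    have h2 : Real.log y ≤ 8 * Real.log (Z + 1) := by linarith
    have h3 := mul_le_mul_of_nonneg_left h2 (mul_nonneg hx0.le hφ.le)
    nlinarith
  have herr : (Z : ℝ) + 2 * (Z : ℝ) ^ 4 ≤ 6 * x / (Nat.totient q * Real.log y) := by
    have h1 : (Z : ℝ) ^ 4 ≤ u ^ 4 := by gcongr
    have h2 : u ≤ u ^ 4 := le_self_pow₀ hu1 (by norm_num)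
    rw [le_div_iff₀ (by positivity)]
    calc ((Z : ℝ) + 2 * (Z : ℝ) ^ 4) * (Nat.totient q * Real.log y)
        ≤ (3 * u ^ 4) * (q * (2 * u ^ 4)) := by
          gcongr
          linarith
      _ = 6 * (q * u ^ 8) := by ring
      _ = 6 * x := by
          rw [hu8, hy]
          field_simp
  have hcount := BrunTitchmarsh.card_primes_le_add_siftedSum q a Z x
  have hsift := BrunTitchmarsh.siftedSum_residueSieve_le (a := a) hq hx0.le hZ
  calc _ ≤ (Z : ℝ) + (BrunTitchmarsh.residueSieve q a Z x).siftedSum := by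
        convert hcount
    _ ≤ 16 * x / (Nat.totient q * Real.log y) + 6 * x / (Nat.totient q * Real.log y) := by
        linarith
    _ = 22 * x / (Nat.totient q * Real.log y) := by ring
end

section
/- (Bender–Pomerance lower bound for smooth polynomials) Let q be a prime power and F_q the finite field with q elements. For positive integers m and k, let N_q(m,k) denote the number of monic polynomials f ∈ F_q[X] with deg f ≤ m all of whose irreducible factors have degree at most k. Then for all integers m, k with 1 ≤ k ≤ √m, N_q(m,k) ≥ q^m / m^{u}, where u = m/k. -/
open Polynomial in
/-- In a finite extension, every element is a root of a monic polynomial of degree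
the degree of the extension. -/
lemma exists_monic_natDegree_eq_finrank_aeval_eq_zero (F : Type*) {L : Type*} [Field F] [Field L]
    [Algebra F L] [FiniteDimensional F L] (a : L) :
    ∃ p : F[X], p.Monic ∧ p.natDegree = Module.finrank F L ∧ aeval a p = 0 := by
  refine ⟨(Algebra.lmul F L a).charpoly, LinearMap.charpoly_monic _,
    LinearMap.charpoly_natDegree _, Algebra.lmul_injective (R := F) ?_⟩
  rw [map_zero, ← aeval_algHom_apply]
  exact LinearMap.aeval_self_charpoly _

open Polynomial in
lemma finite_natDegree_le (F : Type*) [Field F] [Finite F] (n : ℕ) :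
    {f : F[X] | f.natDegree ≤ n}.Finite := by
  have : Finite (degreeLT F (n + 1)) := .of_equiv _ (degreeLTEquiv F (n + 1)).toEquiv.symm
  refine (Set.toFinite (degreeLT F (n + 1) : Set F[X])).subset fun f hf => ?_
  rw [SetLike.mem_coe, mem_degreeLT]
  exact degree_le_natDegree.trans_lt (by exact_mod_cast Nat.lt_succ_of_le hf)

open Polynomial in
/-- Multiplying `d` monic polynomials of degree `k` by a monic polynomial of degree `r ≤ k` gives
many `k`-smooth polynomials of degree `k * d + r`. -/
lemma card_pow_le_card_smooth_mul_pow (F : Type*) [Field F] [Fintype F] {k r : ℕ} (d : ℕ)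
    (hk : 1 ≤ k) (hr : r ≤ k) :
    Fintype.card F ^ (k * d + r) ≤
      Nat.card {f : F[X] // f.Monic ∧ f.natDegree ≤ k * d + r ∧
        ∀ g : F[X], Irreducible g → g ∣ f → g.natDegree ≤ k} * (k * d + r) ^ d := by
  classical
  obtain ⟨p, _⟩ := CharP.exists F
  have : Fact p.Prime := ⟨CharP.char_is_prime F p⟩
  have : NeZero k := ⟨by omega⟩
  let L := FiniteField.Extension F p k
  have : Fintype L := Fintype.ofFinite L
  have hL : Fintype.card L = Fintype.card F ^ k := by
    rw [← Nat.card_eq_fintype_card, ← Nat.card_eq_fintype_card]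
    exact FiniteField.natCard_extension F p k
  have : Fintype (degreeLT F r) := .ofEquiv _ (degreeLTEquiv F r).toEquiv.symm
  have hD : Fintype.card (degreeLT F r) = Fintype.card F ^ r := by
    rw [Fintype.card_congr (degreeLTEquiv F r).toEquiv]; simp
  choose P hPm hPd hPa using
    exists_monic_natDegree_eq_finrank_aeval_eq_zero F (L := L)
  rw [FiniteField.finrank_extension F p k] at hPd
  have hh (c : degreeLT F r) : (X ^ r + (c : F[X])).Monic :=
    monic_X_pow_add (mem_degreeLT.1 c.2)
  have hhd (c : degreeLT F r) : (X ^ r + (c : F[X])).natDegree = r := by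
    rw [natDegree_eq_of_degree_eq_some]
    rw [degree_add_eq_left_of_degree_lt, degree_X_pow]
    rw [degree_X_pow]; exact mem_degreeLT.1 c.2
  let Φ : (Fin d → L) × degreeLT F r → F[X] := fun x => (∏ i, P (x.1 i)) * (X ^ r + (x.2 : F[X]))
  have hprod (x : Fin d → L) : (∏ i, P (x i)).Monic := monic_prod_of_monic _ _ fun i _ => hPm _
  have hΦm (x) : (Φ x).Monic := (hprod x.1).mul (hh x.2)
  have hΦd (x) : (Φ x).natDegree = k * d + r := by
    rw [(hprod x.1).natDegree_mul (hh x.2), hhd, natDegree_prod_of_monic _ _ fun i _ => hPm _]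
    simp [hPd, mul_comm]
  have hΦs (x) (g : F[X]) (hg : Irreducible g) (hgd : g ∣ Φ x) : g.natDegree ≤ k := by
    rcases hg.prime.dvd_or_dvd hgd with h | h
    · obtain ⟨i, -, hi⟩ := hg.prime.exists_mem_finset_dvd h
      exact hPd (x.1 i) ▸ natDegree_le_of_dvd hi (hPm _).ne_zero
    · exact (natDegree_le_of_dvd h (hh _).ne_zero).trans ((hhd x.2).trans_le hr)
  have hfib (f : F[X]) (hf : f ∈ Finset.univ.image Φ) :
      (Finset.univ.filter fun x => Φ x = f).card ≤ (k * d + r) ^ d := by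
    obtain ⟨y, -, rfl⟩ := Finset.mem_image.1 hf
    set R : Finset L := ((Φ y).map (algebraMap F L)).roots.toFinset with hR
    have hRc : R.card ≤ k * d + r := by
      rw [← hΦd y]
      exact (Multiset.toFinset_card_le _).trans ((card_roots' _).trans natDegree_map_le)
    calc _ ≤ (Fintype.piFinset fun _ : Fin d => R).card := by
          refine Finset.card_le_card_of_injOn Prod.fst ?_ ?_
          · intro x hx
            have hx : Φ x = Φ y := by simpa using hx
            rw [Finset.mem_coe, Fintype.mem_piFinset]
            intro i
            rw [hR, Multiset.mem_toFinset, mem_roots ((hΦm y).map _).ne_zero, IsRoot.def,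
              eval_map_algebraMap, ← hx]
            have : aeval (x.1 i) (∏ j, P (x.1 j)) = 0 := by
              rw [map_prod]
              exact Finset.prod_eq_zero (Finset.mem_univ i) (hPa _)
            simp only [Φ, map_mul, this, zero_mul]
          · intro x hx z hz hxz
            have hx : Φ x = Φ y := by simpa using hx
            have hz : Φ z = Φ y := by simpa using hz
            have h := hx.trans hz.symm
            simp only [Φ, hxz] at h
            exact Prod.ext hxz
              (Subtype.ext (add_left_cancel (mul_left_cancel₀ (hprod z.1).ne_zero h)))
      _ = R.card ^ d := by simp
      _ ≤ _ := Nat.pow_le_pow_left hRc d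
  have hcard := Finset.card_le_mul_card_image Finset.univ _ hfib
  have hS : {f : F[X] | f.Monic ∧ f.natDegree ≤ k * d + r ∧
      ∀ g : F[X], Irreducible g → g ∣ f → g.natDegree ≤ k}.Finite :=
    (finite_natDegree_le F (k * d + r)).subset fun f hf => hf.2.1
  have himg : (Finset.univ.image Φ).card ≤ Nat.card {f : F[X] // f.Monic ∧
      f.natDegree ≤ k * d + r ∧ ∀ g : F[X], Irreducible g → g ∣ f → g.natDegree ≤ k} := by
    rw [← Set.ncard_coe_finset]
    refine Set.ncard_le_ncard ?_ hS
    intro f hf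
    obtain ⟨x, -, rfl⟩ := Finset.mem_image.1 (Finset.mem_coe.1 hf)
    exact ⟨hΦm x, (hΦd x).le, hΦs x⟩
  calc Fintype.card F ^ (k * d + r) = Finset.univ.card (α := (Fin d → L) × degreeLT F r) := by
        simp [hL, hD, pow_add, pow_mul]
    _ ≤ (k * d + r) ^ d * (Finset.univ.image Φ).card := hcard
    _ ≤ _ := by rw [mul_comm]; exact Nat.mul_le_mul_right _ himg

/-- Bender–Pomerance lower bound for smooth polynomials over a finite field `F` with
`q = Fintype.card F` elements: for `1 ≤ k ≤ √m`, the number `N_q(m,k)` of monic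
polynomials of degree at most `m` all of whose irreducible factors have degree at most
`k` satisfies `N_q(m,k) ≥ q^m / m^u` with `u = m/k`. -/
theorem bender_pomerance_smooth_poly_lower
    (F : Type*) [Field F] [Fintype F] (m k : ℕ) (hk : 1 ≤ k) (hkm : (k : ℝ) ≤ Real.sqrt m) :
    (Fintype.card F : ℝ) ^ m / (m : ℝ) ^ ((m : ℝ) / (k : ℝ)) ≤
      (Nat.card {f : Polynomial F // f.Monic ∧ f.natDegree ≤ m ∧
        ∀ g : Polynomial F, Irreducible g → g ∣ f → g.natDegree ≤ k} : ℝ) := by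
  have hm : 1 ≤ m := by
    by_contra! h
    obtain rfl : m = 0 := by omega
    simp only [Nat.cast_zero, Real.sqrt_zero] at hkm
    have : k ≤ 0 := by exact_mod_cast hkm
    omega
  have hm' : (1 : ℝ) ≤ m := by exact_mod_cast hm
  have key := card_pow_le_card_smooth_mul_pow F (m / k) hk (Nat.mod_lt m hk).le
  rw [Nat.div_add_mod] at key
  rw [div_le_iff₀ (by positivity)]
  calc (Fintype.card F : ℝ) ^ m ≤ (Nat.card {f : Polynomial F // f.Monic ∧ f.natDegree ≤ m ∧
        ∀ g : Polynomial F, Irreducible g → g ∣ f → g.natDegree ≤ k} : ℝ) *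
          (m : ℝ) ^ (m / k) := by exact_mod_cast key
    _ ≤ _ := by
      refine mul_le_mul_of_nonneg_left ?_ (Nat.cast_nonneg _)
      rw [← Real.rpow_natCast]
      exact Real.rpow_le_rpow_of_exponent_le hm' Nat.cast_div_le
end

section
/- (Balog–Wooley: consecutive smooth integers) For every positive integer k and every real ε > 0, there exist infinitely many positive integers n such that for every i with 1 ≤ i ≤ k, the integer n + i is n^ε-smooth (i.e., every prime p dividing n + i satisfies p ≤ n^ε). -/
open Finset in
/-- The totient of a product of distinct primes, bounded through the sum of their reciprocals. -/
theorem totient_prod_primes_le_exp (S : Finset ℕ) (hS : ∀ p ∈ S, p.Prime) :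
    (Nat.totient (∏ p ∈ S, p) : ℝ) ≤
      Real.exp (-∑ p ∈ S, (1 : ℝ) / p) * ((∏ p ∈ S, p : ℕ) : ℝ) := by
  induction S using Finset.induction_on with
  | empty => simp
  | insert q S hq ih =>
    have hqp : q.Prime := hS q (mem_insert_self q S)
    have hSp : ∀ p ∈ S, p.Prime := fun p hp => hS p (mem_insert_of_mem hp)
    have hcop : Nat.Coprime q (∏ p ∈ S, p) := Nat.Coprime.prod_right fun p hp =>
      (Nat.coprime_primes hqp (hSp p hp)).2 fun h => hq (h ▸ hp)
    have hq0 : (0 : ℝ) < q := by exact_mod_cast hqp.pos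
    have hfactor : (q : ℝ) - 1 ≤ Real.exp (-(1 / q : ℝ)) * q := by
      have := mul_le_mul_of_nonneg_right (Real.add_one_le_exp (-(1 / q : ℝ))) hq0.le
      calc (q : ℝ) - 1 = (-(1 / q : ℝ) + 1) * q := by field_simp; ring
        _ ≤ _ := this
    rw [prod_insert hq, sum_insert hq, Nat.totient_mul hcop, Nat.totient_prime hqp, neg_add,
      Real.exp_add, Nat.cast_mul, Nat.cast_mul, Nat.cast_sub hqp.one_le, Nat.cast_one]
    calc ((q : ℝ) - 1) * (Nat.totient (∏ p ∈ S, p) : ℝ)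
        ≤ (Real.exp (-(1 / q : ℝ)) * q) *
          (Real.exp (-∑ p ∈ S, (1 : ℝ) / p) * ((∏ p ∈ S, p : ℕ) : ℝ)) :=
          mul_le_mul hfactor (ih hSp) (by positivity) (by positivity)
      _ = _ := by ring

open Finset in
/-- The ratio `φ m / m` is arbitrarily small on integers coprime to a given one. -/
theorem exists_coprime_totient_le_mul (M : ℕ) (hM : 0 < M) (δ : ℝ) (hδ : 0 < δ) (hδ1 : δ < 1) :
    ∃ m : ℕ, 1 < m ∧ M.Coprime m ∧ (Nat.totient m : ℝ) ≤ δ * m := by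
  set f : ℕ → ℝ := Set.indicator {p | p.Prime} (fun n : ℕ => (1 : ℝ) / n) with hf
  have hf0 : ∀ n, 0 ≤ f n := fun n => Set.indicator_nonneg (fun _ _ => by positivity) n
  have htend := (not_summable_iff_tendsto_nat_atTop_of_nonneg hf0).1
    not_summable_one_div_on_primes
  obtain ⟨N, hN⟩ := (htend.eventually_ge_atTop
    (-Real.log δ + ∑ i ∈ range (M + 1), f i)).exists
  set S := (Ico (M + 1) N).filter Nat.Prime with hS
  have hSp : ∀ p ∈ S, p.Prime := fun p hp => (mem_filter.1 hp).2
  have hsum : -Real.log δ ≤ ∑ p ∈ S, (1 : ℝ) / p := by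
    have hle : ∑ i ∈ range N, f i ≤ ∑ i ∈ range (M + 1), f i + ∑ i ∈ Ico (M + 1) N, f i := by
      rw [← sum_union (by
        rw [disjoint_left]; intro a; simp only [mem_range, mem_Ico]; omega)]
      refine sum_le_sum_of_subset_of_nonneg (fun a => ?_) fun _ _ _ => hf0 _
      simp only [mem_union, mem_range, mem_Ico]; omega
    have heq : ∑ i ∈ Ico (M + 1) N, f i = ∑ p ∈ S, (1 : ℝ) / p := by
      rw [hS, sum_filter]
      exact sum_congr rfl fun i _ => by simp [hf, Set.indicator_apply]
    linarith
  have hpos : 0 < ∏ p ∈ S, p := prod_pos fun p hp => (hSp p hp).pos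
  have hle : (Nat.totient (∏ p ∈ S, p) : ℝ) ≤ δ * ((∏ p ∈ S, p : ℕ) : ℝ) := by
    refine (totient_prod_primes_le_exp S hSp).trans
      (mul_le_mul_of_nonneg_right ?_ (Nat.cast_nonneg _))
    rw [← Real.le_log_iff_exp_le hδ]
    linarith
  refine ⟨∏ p ∈ S, p, ?_, ?_, hle⟩
  · by_contra h
    have h1 : ∏ p ∈ S, p = 1 := by omega
    rw [h1] at hle
    norm_num at hle
    linarith
  · refine Nat.Coprime.prod_right fun p hp => ((hSp p hp).coprime_iff_not_dvd.2 fun hd => ?_).symm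
    have h1 := Nat.le_of_dvd hM hd
    have h2 := (mem_Ico.1 (mem_filter.1 hp).1).1
    omega

/-- There is a single integer `c` such that each `c / j` with `1 ≤ j ≤ k` is a perfect power
whose exponent `m` has `φ m / m` small. -/
theorem exists_simultaneous_mul_pow (δ : ℝ) (hδ : 0 < δ) (hδ1 : δ < 1) (k : ℕ) :
    ∃ M c : ℕ, 0 < M ∧ 0 < c ∧ ∀ j : ℕ, 1 ≤ j → j ≤ k →
      ∃ m w : ℕ, m ∣ M ∧ (Nat.totient m : ℝ) ≤ δ * m ∧ c = j * w ^ m := by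
  induction k with
  | zero => exact ⟨1, 1, one_pos, one_pos, fun j h1 h2 => by omega⟩
  | succ k ih =>
    obtain ⟨M, c, hM, hc, h⟩ := ih
    obtain ⟨m, hm1, hcop, hm⟩ := exists_coprime_totient_le_mul M hM δ hδ hδ1
    obtain ⟨b, -, hb⟩ := Nat.exists_mul_mod_eq_one_of_coprime hcop hm1
    obtain ⟨q, hq⟩ : ∃ q, M * b = 1 + m * q := ⟨M * b / m, by
      have := Nat.mod_add_div (M * b) m
      omega⟩
    obtain ⟨l, rfl⟩ : ∃ l, m = l + 1 := ⟨m - 1, by omega⟩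
    set s := c ^ (b * l) * (k + 1) ^ b with hs
    refine ⟨M * (l + 1), c * s ^ M, by positivity, by positivity, fun j hj1 hjk => ?_⟩
    rcases Nat.lt_or_ge k j with hkj | hkj
    · obtain rfl : j = k + 1 := by omega
      refine ⟨l + 1, c ^ (1 + q * l) * (k + 1) ^ q, dvd_mul_left _ _, hm, ?_⟩
      have e1 : 1 + b * l * M = (1 + q * l) * (l + 1) := by
        linear_combination l * hq
      have e2 : b * M = 1 + q * (l + 1) := by linear_combination hq
      calc c * s ^ M = c ^ (1 + b * l * M) * (k + 1) ^ (b * M) := by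
            rw [hs]; ring
        _ = (k + 1) * (c ^ (1 + q * l) * (k + 1) ^ q) ^ (l + 1) := by
            rw [e1, e2, mul_pow, ← pow_mul, ← pow_mul, pow_add (k + 1), pow_one]; ring
    · obtain ⟨m', w, ⟨d, rfl⟩, hm', hcw⟩ := h j hj1 hkj
      refine ⟨m', w * s ^ d, Dvd.intro _ (mul_assoc _ _ _).symm, hm', ?_⟩
      rw [mul_pow w, ← pow_mul s, mul_comm d m', ← mul_assoc, ← hcw]

/-- A prime factor of `W ^ m - 1` divides a cyclotomic factor, so it is at most
`(W + 1) ^ φ m`. -/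
theorem prime_le_of_dvd_pow_sub_one {W m p : ℕ} (hW : 1 < W) (hm : 0 < m) (hp : p.Prime)
    (hd : (p : ℤ) ∣ (W : ℤ) ^ m - 1) : (p : ℝ) ≤ ((W : ℝ) + 1) ^ Nat.totient m := by
  have hprod := congrArg (Polynomial.eval (W : ℤ))
    (Polynomial.prod_cyclotomic_eq_X_pow_sub_one hm ℤ)
  simp only [Polynomial.eval_prod, Polynomial.eval_sub, Polynomial.eval_pow, Polynomial.eval_X,
    Polynomial.eval_one] at hprod
  rw [← hprod, (Nat.prime_iff_prime_int.1 hp).dvd_finsetProd_iff] at hd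
  obtain ⟨d, hdm, hpd⟩ := hd
  have hle := Int.le_of_dvd (Polynomial.cyclotomic_pos' d (by exact_mod_cast hW)) hpd
  have hW' : (1 : ℝ) < W := by exact_mod_cast hW
  have heval : ((Polynomial.eval (W : ℤ) (Polynomial.cyclotomic d ℤ) : ℤ) : ℝ) =
      Polynomial.eval (W : ℝ) (Polynomial.cyclotomic d ℝ) := by
    rw [← Polynomial.map_cyclotomic_int d ℝ]
    simpa using (Polynomial.eval_intCast_map (Int.castRingHom ℝ)
      (Polynomial.cyclotomic d ℤ) (W : ℤ)).symm
  calc (p : ℝ) ≤ ((Polynomial.eval (W : ℤ) (Polynomial.cyclotomic d ℤ) : ℤ) : ℝ) := by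
        exact_mod_cast hle
    _ = Polynomial.eval (W : ℝ) (Polynomial.cyclotomic d ℝ) := heval
    _ ≤ ((W : ℝ) + 1) ^ Nat.totient d := Polynomial.cyclotomic_eval_le_add_one_pow_totient hW' d
    _ ≤ ((W : ℝ) + 1) ^ Nat.totient m := by
        refine pow_le_pow_right₀ (by linarith) (Nat.le_of_dvd (Nat.totient_pos.2 hm) ?_)
        exact Nat.totient_dvd_of_dvd (Nat.dvd_of_mem_divisors hdm)

/-- When `φ m ≤ δ m`, the quantity `(W + 1) ^ φ m` is at most `(W ^ m) ^ (2 δ)`. -/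
theorem add_one_pow_totient_le_rpow {W m : ℕ} (hW : 1 < W) {δ : ℝ}
    (hm : (Nat.totient m : ℝ) ≤ δ * m) :
    ((W : ℝ) + 1) ^ Nat.totient m ≤ ((W : ℝ) ^ m) ^ (2 * δ) := by
  have hW' : (2 : ℝ) ≤ W := by exact_mod_cast hW
  calc ((W : ℝ) + 1) ^ Nat.totient m ≤ ((W : ℝ) ^ 2) ^ Nat.totient m :=
        pow_le_pow_left₀ (by positivity) (by nlinarith) _
    _ = (W : ℝ) ^ (2 * (Nat.totient m : ℝ)) := by
        rw [← pow_mul, ← Real.rpow_natCast]; push_cast; rfl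
    _ ≤ (W : ℝ) ^ ((m : ℝ) * (2 * δ)) :=
        Real.rpow_le_rpow_of_exponent_le (by linarith) (by linarith)
    _ = ((W : ℝ) ^ m) ^ (2 * δ) := by
        rw [Real.rpow_mul (by positivity), Real.rpow_natCast]

/-- Balog–Wooley: for every `k` and `ε > 0` there are infinitely many `n` such that
`n+1, …, n+k` are all `n^ε`-smooth. -/
theorem balog_wooley_consecutive_smooth (k : ℕ) (hk : 0 < k) (ε : ℝ) (hε : 0 < ε) :
    ∀ N : ℕ, ∃ n : ℕ, N ≤ n ∧ 0 < n ∧ ∀ i : ℕ, 1 ≤ i → i ≤ k →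
      ∀ p : ℕ, Nat.Prime p → p ∣ (n + i) → (p : ℝ) ≤ (n : ℝ) ^ ε := by
  intro N
  set δ : ℝ := min (ε / 4) (1 / 2) with hδdef
  have hδ : 0 < δ := lt_min (by linarith) (by norm_num)
  have hδ1 : δ < 1 := (min_le_right _ _).trans_lt (by norm_num)
  have hδε : 4 * δ ≤ ε := by linarith [min_le_left (ε / 4) (1 / 2 : ℝ)]
  obtain ⟨M, c, hM, hc, h⟩ := exists_simultaneous_mul_pow δ hδ hδ1 k
  set B := ⌈(k : ℝ) ^ (1 / ε)⌉₊ with hB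
  set z := N + B + 2 * (k + 1) with hz
  have hzX : z ≤ c * z ^ M :=
    (Nat.le_self_pow hM.ne' z).trans (Nat.le_mul_of_pos_left _ hc)
  obtain ⟨n, hn⟩ : ∃ n, c * z ^ M = n + (k + 1) := ⟨c * z ^ M - (k + 1), by omega⟩
  have hnk : k + 1 ≤ n := by omega
  have hn2 : (2 : ℝ) ≤ n := by exact_mod_cast (by omega : 2 ≤ n)
  refine ⟨n, by omega, by omega, fun i hi1 hik p hp hpd => ?_⟩
  obtain ⟨j, hj⟩ : ∃ j, i + j = k + 1 := ⟨k + 1 - i, by omega⟩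
  obtain ⟨m, w, ⟨d, rfl⟩, hm, hcw⟩ := h j (by omega) (by omega)
  have hm0 : 0 < m := Nat.pos_of_mul_pos_right hM
  have hd0 : 0 < d := Nat.pos_of_mul_pos_left hM
  set W := w * z ^ d with hW
  have hX : j * W ^ m = n + (k + 1) := by
    rw [← hn, hcw, hW, mul_pow, ← pow_mul, mul_comm d m, mul_assoc]
  have hw0 : 0 < w := Nat.pos_of_ne_zero fun h0 => by
    rw [h0, zero_pow hm0.ne'] at hcw
    omega
  have hW1 : 1 < W := by
    have : z ≤ W := (Nat.le_self_pow hd0.ne' z).trans (Nat.le_mul_of_pos_left _ hw0)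
    omega
  have hfac : ((n + i : ℕ) : ℤ) = j * ((W : ℤ) ^ m - 1) := by
    have h1 : (j : ℤ) * (W : ℤ) ^ m = n + (k + 1) := by exact_mod_cast hX
    have h2 : (i : ℤ) + j = k + 1 := by exact_mod_cast hj
    push_cast
    linarith
  have hpd' : (p : ℤ) ∣ j * ((W : ℤ) ^ m - 1) := hfac ▸ Int.natCast_dvd_natCast.2 hpd
  rcases (Nat.prime_iff_prime_int.1 hp).dvd_or_dvd hpd' with hpj | hpW
  · have hpk : p ≤ k := (Nat.le_of_dvd (by omega) (Int.natCast_dvd_natCast.1 hpj)).trans (by omega)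
    calc (p : ℝ) ≤ k := by exact_mod_cast hpk
      _ = ((k : ℝ) ^ (1 / ε)) ^ ε := by
          rw [← Real.rpow_mul (by positivity), one_div_mul_cancel hε.ne', Real.rpow_one]
      _ ≤ (n : ℝ) ^ ε := by
          refine Real.rpow_le_rpow (by positivity) ((Nat.le_ceil _).trans ?_) hε.le
          exact_mod_cast (by omega : B ≤ n)
  · have hWn : (W : ℝ) ^ m ≤ (n : ℝ) ^ 2 := by
      have h1 : W ^ m ≤ 2 * n := by
        have := Nat.le_mul_of_pos_left (W ^ m) (by omega : 0 < j)
        omega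
      have h2 : (W : ℝ) ^ m ≤ 2 * n := by exact_mod_cast h1
      nlinarith
    calc (p : ℝ) ≤ ((W : ℝ) + 1) ^ Nat.totient m := prime_le_of_dvd_pow_sub_one hW1 hm0 hp hpW
      _ ≤ ((W : ℝ) ^ m) ^ (2 * δ) := add_one_pow_totient_le_rpow hW1 hm
      _ ≤ ((n : ℝ) ^ 2) ^ (2 * δ) := Real.rpow_le_rpow (by positivity) hWn (by positivity)
      _ = (n : ℝ) ^ (4 * δ) := by
          rw [← Real.rpow_natCast, ← Real.rpow_mul (by positivity)]; congr 1; push_cast; ring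
      _ ≤ (n : ℝ) ^ ε := Real.rpow_le_rpow_of_exponent_le (by linarith) hδε
end
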